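/- Let p ≥ 4, 1 ≤ a ≤ p−2 and 2 ≤ b ≤ p−1 be integers and let L ≥ 0. If a + b is odd then F^{p,1}_{p−a,b}(L) + δ_{L,0} δ_{a,b} = q^{φ(p−a,p−1) + φ(a,b) − a(a−1)/4} B^p_{a,b}(L, b+1), while if a + b is even then F^{p,1}_{p−a,b}(L) + δ_{L,0} δ_{a,b} = q^{φ̃(p−a,p−1) + φ̃(a,b) − (a−1)(a+2)/4} B̃^p_{a,b}(L, b+2), for every real q with 0 < q < 1, where φ(a,b) = (b−a)(b−a+1)/4, φ̃(a,b) = (b−a)(b−a+3)/4, and by convention F^{p,1}_{p−1,b}(L) ≡ F^{p,0}_{1,b}(L). -/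

import Mathlib

open Finset

noncomputable section

/-- `(q)_k = ∏_{j=1}^k (1 - q^j)`. -/
def qPoch (q : ℝ) (k : ℕ) : ℝ := ∏ j ∈ Finset.range k, (1 - q ^ (j + 1))

/-- The Andrews–Baxter `q`-trinomial coefficient `T^n(L,A)`. -/
def qTri (q : ℝ) (n : ℤ) (L : ℕ) (A : ℤ) : ℝ :=
  if |A| ≤ (L : ℤ) then
    ∑ j ∈ Finset.range (L + 1),
      if 0 ≤ (j : ℤ) + A ∧ 0 ≤ (L : ℤ) - 2 * j - A then
        q ^ ((j : ℤ) * ((j : ℤ) + A - n)) * qPoch q L /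
          (qPoch q j * qPoch q (((j : ℤ) + A).toNat) * qPoch q (((L : ℤ) - 2 * j - A).toNat))
      else 0
  else 0

/-- Bosonic polynomial `B^p_{a,b}(L,s)`. -/
def Bpoly (q : ℝ) (p a b s : ℤ) (L : ℕ) : ℝ :=
  ∑' j : ℤ,
    (q ^ (p * (p + 1) * j ^ 2 + j * ((p + 1) * a - p * s)) * qTri q 0 L (2 * p * j + a - b)
      - q ^ ((p * j + a) * ((p + 1) * j + s)) * qTri q 0 L (2 * p * j + a + b))

/-- Bosonic polynomial `B̃^p_{a,b}(L,s)`. -/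
def Btpoly (q : ℝ) (p a b s : ℤ) (L : ℕ) : ℝ :=
  ∑' j : ℤ,
    (q ^ (p * (p + 1) * j ^ 2 + j * ((p + 1) * a - p * s)) * qTri q 1 L (2 * p * j + a - b)
      - q ^ (p * (p + 1) * j ^ 2 + j * ((p + 1) * a + p * (s - 2)) + a * (s - 1) - b)
        * qTri q 1 L (2 * p * j + a + b))

/-- `(q)_∞`. -/
def qPochInf (q : ℝ) : ℝ := ∏' j : ℕ, (1 - q ^ (j + 1))

/-- The matrix `Ĩ_{p-1}`. -/
def ItM (p : ℕ) (i j : Fin (p - 1)) : ℚ :=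
  if i.val = 0 then (if j.val = 2 then -1 else 0)
  else if j.val = 0 then (if i.val = 2 then 1 else 0)
  else if i.val = j.val + 1 ∨ j.val = i.val + 1 then 1 else 0

/-- The matrix `C̃_{p-1} = 2·Id - Ĩ_{p-1}`. -/
def CtM (p : ℕ) (i j : Fin (p - 1)) : ℚ := (if i = j then 2 else 0) - ItM p i j

/-- Unit vector `e_c` (zero if `c` is out of range). -/
def evec (p c : ℕ) : Fin (p - 1) → ℚ := fun i => if i.val = c then 1 else 0

/-- Kronecker delta. -/
def kdel (a b : ℕ) : ℕ := if a = b then 1 else 0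

/-- `p̃(n) = 1` if `n` is odd, `0` otherwise. -/
def ptil (n : ℕ) : ℚ := if n % 2 = 1 then 1 else 0

/-- The vector `u^i_{a,b}`. -/
def uvec (p i a b : ℕ) : Fin (p - 1) → ℚ := fun j =>
  (if 1 < a then evec p a j else 0) + (if 1 < b then evec p b j else 0)
    + ptil (a + kdel a 1 + b + kdel b 1 + (if i = 1 then p - 1 else 0)) * (evec p 1 j - evec p 0 j)

/-- The vector `A^i_{a,b}`. -/
def Avec (p i a b : ℕ) : Fin (p - 1) → ℚ := fun j =>
  (if 1 < b then evec p b j else 0)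
    + ptil (a + kdel a 1 + b + kdel b 1 + (if i = 1 then p - 1 else 0)) * evec p 1 j

/-- `q`-binomial coefficient with (possibly non-integral) rational top entry:
it vanishes unless the top is an integer `N` with `0 ≤ m ≤ N`. -/
def qBinQ (q : ℝ) (N : ℚ) (m : ℕ) : ℝ :=
  if N.den = 1 ∧ (m : ℚ) ≤ N then
    qPoch q N.num.toNat / (qPoch q m * qPoch q (N.num.toNat - m))
  else 0

/-- The quadratic form `Φ(m) = (m·C̃m)/4 - (A·m)/2`. -/
def PhiQ (p : ℕ) (A : Fin (p - 1) → ℚ) (m : Fin (p - 1) → ℕ) : ℚ :=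
  (∑ i, ∑ j, (m i : ℚ) * CtM p i j * (m j : ℚ)) / 4 - (∑ j, A j * (m j : ℚ)) / 2

/-- The vector `(½ Ĩ m + L e₀ + ½ u)`. -/
def topVec (p L : ℕ) (u : Fin (p - 1) → ℚ) (m : Fin (p - 1) → ℕ) (i : Fin (p - 1)) : ℚ :=
  (∑ j, ItM p i j * (m j : ℚ)) / 2 + (L : ℚ) * evec p 0 i + u i / 2

/-- The last component `m_{p-2}`. -/
def mlast (p : ℕ) (m : Fin (p - 1) → ℕ) : ℕ :=
  if h : p - 1 ≠ 0 then m ⟨p - 2, by omega⟩ else 0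

/-- The fundamental fermionic form `f^p_k(L; u; A)`. -/
def fFerm (q : ℝ) (p k L : ℕ) (u A : Fin (p - 1) → ℚ) : ℝ :=
  ∑' m : Fin (p - 1) → ℕ,
    if mlast p m % 2 = k % 2 then
      q ^ ((PhiQ p A m : ℝ)) * ∏ i, qBinQ q (topVec p L u m i) (m i)
    else 0

/-- The fermionic polynomial `F^{p,i}_{a,b}(L)`. -/
def Fpoly (q : ℝ) (p i a b L : ℕ) : ℝ :=
  if b = p - 1 then fFerm q p (1 - i) L (uvec p i a b) (Avec p i a b)
  else fFerm q p i L (uvec p i a b) (Avec p i a b)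

def phiR (a b : ℝ) : ℝ := (b - a) * (b - a + 1) / 4

def phitR (a b : ℝ) : ℝ := (b - a) * (b - a + 3) / 4

/-- Virasoro character `χ^{p,p+1}_{r,s}(q)` of the minimal model `M(p,p+1)`. -/
def chiV (p r s : ℤ) (q : ℝ) : ℝ :=
  (∑' j : ℤ, (q ^ (p * (p + 1) * j ^ 2 + j * ((p + 1) * r - p * s))
      - q ^ ((p * j + r) * ((p + 1) * j + s)))) / qPochInf q

lemma qPoch_pos {q : ℝ} (h0 : 0 < q) (h1 : q < 1) (k : ℕ) : 0 < qPoch q k := by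
  unfold qPoch
  refine Finset.prod_pos fun j _ => ?_
  have := pow_lt_one₀ h0.le h1 (Nat.succ_ne_zero j)
  simpa using this

lemma qPoch_succ (q : ℝ) (k : ℕ) : qPoch q (k + 1) = qPoch q k * (1 - q ^ (k + 1)) := by
  unfold qPoch
  rw [Finset.prod_range_succ]

lemma qPoch_zero (q : ℝ) : qPoch q 0 = 1 := by simp [qPoch]

/-- Gaussian binomial with integer arguments, zero outside the range. -/
def gb (q : ℝ) (N m : ℤ) : ℝ :=
  if 0 ≤ m ∧ m ≤ N then qPoch q N.toNat / (qPoch q m.toNat * qPoch q (N - m).toNat) else 0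

lemma gb_nonneg {q : ℝ} (h0 : 0 < q) (h1 : q < 1) (N m : ℤ) : 0 ≤ gb q N m := by
  unfold gb
  split_ifs
  · exact (div_pos (qPoch_pos h0 h1 _) (mul_pos (qPoch_pos h0 h1 _) (qPoch_pos h0 h1 _))).le
  · exact le_rfl

lemma gb_zero_right {q : ℝ} (h0 : 0 < q) (h1 : q < 1) {N : ℤ} (hN : 0 ≤ N) : gb q N 0 = 1 := by
  unfold gb
  rw [if_pos ⟨le_rfl, hN⟩]
  simp [qPoch_zero, (qPoch_pos h0 h1 _).ne']

lemma gb_self {q : ℝ} (h0 : 0 < q) (h1 : q < 1) {N : ℤ} (hN : 0 ≤ N) : gb q N N = 1 := by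
  unfold gb
  rw [if_pos ⟨hN, le_rfl⟩]
  simp [qPoch_zero, (qPoch_pos h0 h1 _).ne']

lemma gb_of_neg {q : ℝ} {N m : ℤ} (h : m < 0) : gb q N m = 0 := by
  unfold gb; rw [if_neg]; omega

lemma gb_of_lt {q : ℝ} {N m : ℤ} (h : N < m) : gb q N m = 0 := by
  unfold gb; rw [if_neg]; omega

lemma gb_symm (q : ℝ) (N m : ℤ) : gb q N m = gb q N (N - m) := by
  unfold gb
  by_cases h : 0 ≤ m ∧ m ≤ N
  · rw [if_pos h, if_pos (by omega), sub_sub_cancel, mul_comm]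
  · rw [if_neg h, if_neg (by omega)]

lemma gb_pascal1 {q : ℝ} (h0 : 0 < q) (h1 : q < 1) {N : ℤ} (hN : 1 ≤ N) (m : ℤ) :
    gb q N m = gb q (N - 1) m + q ^ (N - m) * gb q (N - 1) (m - 1) := by
  rcases lt_trichotomy m 0 with h | h | h
  · rw [gb_of_neg h, gb_of_neg h, gb_of_neg (by omega)]; simp
  · subst h
    rw [gb_zero_right h0 h1 (by omega), gb_zero_right h0 h1 (by omega), gb_of_neg (by omega)]; simp
  rcases lt_trichotomy N m with h' | h' | h'
  · rw [gb_of_lt h', gb_of_lt (by omega), gb_of_lt (by omega)]; simp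
  · subst h'
    rw [gb_self h0 h1 (by omega), gb_self h0 h1 (by omega), gb_of_lt (by omega)]; simp
  obtain ⟨a, rfl⟩ : ∃ a : ℕ, m = a + 1 := ⟨(m - 1).toNat, by omega⟩
  obtain ⟨c, rfl⟩ : ∃ c : ℕ, N = a + 1 + c + 1 := ⟨(N - (a + 1) - 1).toNat, by omega⟩
  unfold gb
  rw [if_pos (by omega), if_pos (by omega), if_pos (by omega)]
  rw [show ((a:ℤ) + 1 + c + 1).toNat = a + c + 1 + 1 by omega,
    show ((a:ℤ) + 1).toNat = a + 1 by omega,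
    show ((a:ℤ) + 1 + c + 1 - (a + 1)).toNat = c + 1 by omega,
    show ((a:ℤ) + 1 + c + 1 - 1).toNat = a + c + 1 by omega,
    show ((a:ℤ) + 1 + c + 1 - 1 - (a + 1)).toNat = c by omega,
    show ((a:ℤ) + 1 - 1).toNat = a by omega,
    show ((a:ℤ) + 1 + c + 1 - 1 - (a + 1 - 1)).toNat = c + 1 by omega,
    show ((a:ℤ) + 1 + c + 1 - (a + 1)) = ((c + 1 : ℕ) : ℤ) by push_cast; ring, zpow_natCast]
  rw [qPoch_succ q (a + c + 1), qPoch_succ q a, qPoch_succ q c]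
  have ha := (qPoch_pos h0 h1 a).ne'
  have hc := (qPoch_pos h0 h1 c).ne'
  have e1 : (1 - q ^ (a + 1)) ≠ 0 := by
    have := pow_lt_one₀ h0.le h1 (Nat.succ_ne_zero a); simp at this; linarith
  have e2 : (1 - q ^ (c + 1)) ≠ 0 := by
    have := pow_lt_one₀ h0.le h1 (Nat.succ_ne_zero c); simp at this; linarith
  field_simp
  ring

lemma gb_pascal2 {q : ℝ} (h0 : 0 < q) (h1 : q < 1) {N : ℤ} (hN : 1 ≤ N) (m : ℤ) :
    gb q N m = gb q (N - 1) (m - 1) + q ^ m * gb q (N - 1) m := by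
  rw [gb_symm, gb_pascal1 h0 h1 hN, gb_symm q (N - 1) (N - m), gb_symm q (N - 1) (N - m - 1),
    sub_sub_cancel, show N - 1 - (N - m) = m - 1 by ring, show N - 1 - (N - m - 1) = m by ring]

/-- Gaussian binomial with doubled top. -/
def hb (q : ℝ) (t m : ℤ) : ℝ := if t % 2 = 0 then gb q (t / 2) m else 0

lemma hb_nonneg {q : ℝ} (h0 : 0 < q) (h1 : q < 1) (N m : ℤ) : 0 ≤ hb q N m := by
  unfold hb; split_ifs
  · exact gb_nonneg h0 h1 _ _
  · exact le_rfl

lemma hb_of_neg {q : ℝ} {N m : ℤ} (h : m < 0) : hb q N m = 0 := by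
  unfold hb; rw [gb_of_neg h]; simp

lemma hb_ne_zero {q : ℝ} {t m : ℤ} (h : hb q t m ≠ 0) : t % 2 = 0 ∧ 0 ≤ m ∧ 2 * m ≤ t := by
  unfold hb at h
  split_ifs at h with h2
  · unfold gb at h
    split_ifs at h with h3
    · omega
    · exact absurd rfl h
  · exact absurd rfl h

lemma hb_pascal {q : ℝ} (h0 : 0 < q) (h1 : q < 1) {t : ℤ} (ht : 1 ≤ t) (m : ℤ) :
    hb q t m = q ^ m * hb q (t - 2) m + hb q (t - 2) (m - 1) := by
  unfold hb
  by_cases h : t % 2 = 0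
  · rw [if_pos h, if_pos (by omega), if_pos (by omega), gb_pascal2 h0 h1 (by omega),
      show (t - 2) / 2 = t / 2 - 1 by omega]; ring
  · rw [if_neg h, if_neg (by omega), if_neg (by omega)]; simp

/-- Centered Gaussian binomial `[N, (N-A)/2]`. -/
def bb (q : ℝ) (N A : ℤ) : ℝ := if (N - A) % 2 = 0 then gb q N ((N - A) / 2) else 0

lemma bb_pascal1 {q : ℝ} (h0 : 0 < q) (h1 : q < 1) {r : ℝ} (hr : q = r ^ 4)
    {N : ℤ} (hN : 1 ≤ N) (A : ℤ) :
    bb q N A = bb q (N - 1) (A + 1) + r ^ (2 * (N - A)) * bb q (N - 1) (A - 1) := by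
  unfold bb
  by_cases h : (N - A) % 2 = 0
  · rw [if_pos h, if_pos (by omega), if_pos (by omega), gb_pascal2 h0 h1 hN,
      show (N - 1 - (A + 1)) / 2 = (N - A) / 2 - 1 by omega,
      show (N - 1 - (A - 1)) / 2 = (N - A) / 2 by omega]
    congr 2
    rw [hr, ← zpow_natCast, ← zpow_mul]
    congr 1; push_cast; omega
  · rw [if_neg h, if_neg (by omega), if_neg (by omega)]; simp

lemma bb_pascal2 {q : ℝ} (h0 : 0 < q) (h1 : q < 1) {r : ℝ} (hr : q = r ^ 4)
    {N : ℤ} (hN : 1 ≤ N) (A : ℤ) :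
    bb q N A = bb q (N - 1) (A - 1) + r ^ (2 * (N + A)) * bb q (N - 1) (A + 1) := by
  unfold bb
  by_cases h : (N - A) % 2 = 0
  · rw [if_pos h, if_pos (by omega), if_pos (by omega), gb_pascal1 h0 h1 hN,
      show (N - 1 - (A + 1)) / 2 = (N - A) / 2 - 1 by omega,
      show (N - 1 - (A - 1)) / 2 = (N - A) / 2 by omega]
    congr 2
    rw [hr, ← zpow_natCast, ← zpow_mul]
    congr 1; push_cast; omega
  · rw [if_neg h, if_neg (by omega), if_neg (by omega)]; simp

lemma bb_ne_zero {q : ℝ} {N A : ℤ} (h : bb q N A ≠ 0) : |A| ≤ N ∧ (N - A) % 2 = 0 := by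
  unfold bb at h
  split_ifs at h with h2
  · unfold gb at h
    split_ifs at h with h3
    · rw [abs_le]; omega
    · exact absurd rfl h
  · exact absurd rfl h

lemma vander {q : ℝ} (h0 : 0 < q) (h1 : q < 1) (A B : ℕ) : ∀ N : ℕ,
    ∑ x ∈ antidiagonal N, q ^ ((x.1 : ℤ) * ((B : ℤ) - x.2)) * (gb q A x.1 * gb q B x.2)
      = gb q ((A : ℤ) + B) N := by
  induction A with
  | zero =>
    intro N
    rw [Finset.sum_eq_single (0, N)]
    · simp [gb_zero_right h0 h1]
    · rintro ⟨i, j⟩ hx hne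
      simp only [HasAntidiagonal.mem_antidiagonal] at hx
      have : gb q ((0 : ℕ) : ℤ) i = 0 := by
        apply gb_of_lt
        rcases i with _ | i
        · exfalso; apply hne; simp at hx; simp [hx]
        · push_cast; omega
      simp only [this]; simp
    · simp
  | succ A ih =>
    intro N
    have key : ∀ x : ℕ × ℕ, q ^ ((x.1 : ℤ) * ((B : ℤ) - x.2)) * (gb q ((A + 1 : ℕ) : ℤ) x.1 * gb q B x.2)
        = q ^ ((x.1 : ℤ) * ((B : ℤ) - x.2)) * (gb q A x.1 * gb q B x.2)
          + q ^ ((x.1 : ℤ) * ((B : ℤ) - x.2) + (A + 1 - x.1)) * (gb q A ((x.1 : ℤ) - 1) * gb q B x.2) := by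
      intro x
      rw [gb_pascal1 h0 h1 (by omega), zpow_add₀ h0.ne']
      push_cast
      rw [add_sub_cancel_right]; ring
    rw [Finset.sum_congr rfl fun x _ => key x, Finset.sum_add_distrib, ih]
    push_cast
    rw [gb_pascal1 h0 h1 (N := (A : ℤ) + 1 + B) (by omega),
      show (A : ℤ) + 1 + B - 1 = A + B by ring]
    congr 1
    rcases N with _ | N
    · simp [gb_of_neg]
    · rw [Finset.Nat.sum_antidiagonal_succ]
      rw [gb_of_neg (by simp)]
      push_cast
      rw [add_sub_cancel_right, ← ih N, Finset.mul_sum]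
      simp only [zero_mul, mul_zero, zero_add]
      refine Finset.sum_congr rfl fun x hx => ?_
      simp only [HasAntidiagonal.mem_antidiagonal] at hx
      rw [← mul_assoc (q ^ ((A : ℤ) + 1 + B - (N + 1))), ← zpow_add₀ h0.ne', add_sub_cancel_right]
      congr 2
      rw [← hx]; push_cast; ring

def ev (i : ℕ) : ℕ → ℤ := fun l => if l = i then 1 else 0

def wE (n : ℕ) (A k : ℕ → ℤ) : ℤ :=
  ∑ i ∈ range (n + 1), k (i + 1) * (2 * k (i + 1) - k i - k (i + 2) - 2 * A (i + 1))

def wP (q : ℝ) (n : ℕ) (U k : ℕ → ℤ) : ℝ :=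
  ∏ i ∈ range (n + 1), hb q (k i + k (i + 2) + U (i + 1)) (k (i + 1))

open Classical in
def wt (q r : ℝ) (n : ℕ) (D A k : ℕ → ℤ) : ℝ :=
  if k 0 = 0 ∧ ∀ i, n < i → k i = 0 then r ^ (wE n A k) * wP q n (fun i => A i + D i) k else 0

def Zf (q r : ℝ) (n : ℕ) (D A : ℕ → ℤ) : ℝ := ∑' k : ℕ → ℤ, wt q r n D A k

lemma wt_congr (q r : ℝ) (n : ℕ) (D A A' k : ℕ → ℤ) (h : ∀ i, 1 ≤ i → i ≤ n + 1 → A i = A' i) :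
    wt q r n D A k = wt q r n D A' k := by
  unfold wt wE wP
  congr 2
  · congr 1
    refine Finset.sum_congr rfl fun i hi => ?_
    rw [mem_range] at hi
    rw [h (i + 1) (by omega) (by omega)]
  · refine Finset.prod_congr rfl fun i hi => ?_
    rw [mem_range] at hi
    simp only [h (i + 1) (by omega) (by omega)]

lemma Zf_congr (q r : ℝ) (n : ℕ) (D A A' : ℕ → ℤ) (h : ∀ i, 1 ≤ i → i ≤ n + 1 → A i = A' i) :
    Zf q r n D A = Zf q r n D A' := by
  unfold Zf
  exact tsum_congr fun k => wt_congr q r n D A A' k h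

lemma wt_ne_zero {q r : ℝ} {n : ℕ} {D A k : ℕ → ℤ} (h : wt q r n D A k ≠ 0) :
    k 0 = 0 ∧ (∀ i, n < i → k i = 0) ∧ ∀ i, i ≤ n →
      ((k i + k (i + 2) + (A (i + 1) + D (i + 1))) % 2 = 0 ∧ 0 ≤ k (i + 1) ∧
        2 * k (i + 1) ≤ k i + k (i + 2) + (A (i + 1) + D (i + 1))) := by
  unfold wt at h
  split_ifs at h with h2
  · refine ⟨h2.1, h2.2, fun i hi => ?_⟩
    have h3 := right_ne_zero_of_mul h
    unfold wP at h3
    rw [Finset.prod_ne_zero_iff] at h3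
    exact hb_ne_zero (h3 i (by simp; omega))
  · exact absurd rfl h

lemma wt_nonneg {q r : ℝ} (h0 : 0 < q) (h1 : q < 1) (hr : 0 < r) (n : ℕ) (D A k : ℕ → ℤ) :
    0 ≤ wt q r n D A k := by
  unfold wt
  split_ifs
  · exact mul_nonneg (zpow_pos hr _).le (Finset.prod_nonneg fun i _ => hb_nonneg h0 h1 _ _)
  · exact le_rfl

/-- If the increments of `k` are nonnegative from `i` on and positive at `i`, the end is larger. -/
lemma incr_pos (k : ℕ → ℤ) (i n : ℕ) (hi : i ≤ n) (h1 : k i < k (i + 1))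
    (h : ∀ j, i ≤ j → j ≤ n → k j ≤ k (j + 1)) : k i < k (n + 1) := by
  induction n, hi using Nat.le_induction with
  | base => exact h1
  | succ m hm ih =>
    have := ih (fun j a b => h j a (by omega))
    have := h (m + 1) (by omega) le_rfl
    omega

lemma finite_box (n : ℕ) (B : ℤ) :
    {k : ℕ → ℤ | (∀ i, n < i → k i = 0) ∧ ∀ i, i ≤ n → 0 ≤ k i ∧ k i ≤ B}.Finite := by
  apply Set.Finite.of_finite_image (f := fun k => (fun i : Fin (n + 1) => k i))
  · refine (Set.finite_Icc (0 : Fin (n + 1) → ℤ) (fun _ => B)).subset ?_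
    rintro _ ⟨k, hk, rfl⟩
    refine ⟨fun i => (hk.2 i (by omega)).1, fun i => (hk.2 i (by omega)).2⟩
  · intro k hk l hl h
    funext i
    by_cases hi : i ≤ n
    · exact congrFun h ⟨i, by omega⟩
    · rw [hk.1 i (by omega), hl.1 i (by omega)]

lemma conc_bound (n : ℕ) (M : ℤ) (hM : 0 ≤ M) (k : ℕ → ℤ) (hk0 : k 0 = 0) (hkn : k (n + 1) = 0)
    (hpos : ∀ i, 0 ≤ k i)
    (h : ∀ i, i < n → 2 * k (i + 1) ≤ k i + k (i + 2) + M) :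
    ∀ i, i ≤ n + 1 → k i ≤ i * ((n + 1) * M) := by
  have hd : ∀ i, i ≤ n → k (i + 1) - k i ≤ (n + 1) * M := by
    intro i hi
    by_contra hcon
    push Not at hcon
    have hch : ∀ m : ℕ, i + m ≤ n → k (i + 1) - k i - m * M ≤ k (i + m + 1) - k (i + m) := by
      intro m
      induction m with
      | zero => intro _; simp
      | succ m ih =>
        intro hm
        have e1 := ih (by omega)
        have e2 := h (i + m) (by omega)
        push_cast
        rw [show i + (m + 1) = i + m + 1 by ring]
        linarith
    have hinc := incr_pos k i n hi (by nlinarith) (fun j hj1 hj2 => by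
      have := hch (j - i) (by omega)
      rw [show i + (j - i) = j by omega] at this
      have h3 : ((j - i : ℕ) : ℤ) ≤ n := by omega
      nlinarith)
    have := hpos i
    omega
  intro i
  induction i with
  | zero => intro _; simp [hk0]
  | succ i ih =>
    intro hi
    have e1 := ih (by omega)
    have e2 := hd i (by omega)
    push_cast
    linarith

lemma wt_bound {q r : ℝ} {n : ℕ} {D A k : ℕ → ℤ} {M : ℤ} (hM : 0 ≤ M)
    (hU : ∀ i, i < n → A (i + 1) + D (i + 1) ≤ M) (h : wt q r n D A k ≠ 0) :
    (∀ i, n < i → k i = 0) ∧ ∀ i, i ≤ n → 0 ≤ k i ∧ k i ≤ (n + 1) * ((n + 1) * M) := by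
  obtain ⟨h0, h1, h2⟩ := wt_ne_zero h
  have hpos : ∀ i, 0 ≤ k i := by
    intro i
    rcases i with _ | i
    · exact h0.ge
    · by_cases hi : i ≤ n
      · exact (h2 i hi).2.1
      · exact (h1 (i + 1) (by omega)).ge
  refine ⟨h1, fun i hi => ⟨hpos i, ?_⟩⟩
  have := conc_bound n M hM k h0 (h1 _ (by omega)) hpos (fun i hi => by
    have e1 := (h2 i (by omega)).2.2
    have e2 := hU i hi
    linarith) i (by omega)
  have h3 : (i : ℤ) ≤ n + 1 := by omega
  have h4 : 0 ≤ ((n : ℤ) + 1) * M := by positivity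
  nlinarith

lemma wt_finite (q r : ℝ) (n : ℕ) (D A : ℕ → ℤ) : (Function.support (wt q r n D A)).Finite := by
  have hM : ∃ M : ℤ, 0 ≤ M ∧ ∀ i, i < n → A (i + 1) + D (i + 1) ≤ M := by
    refine ⟨∑ i ∈ range n, |A (i + 1) + D (i + 1)|, Finset.sum_nonneg fun i _ => abs_nonneg _, ?_⟩
    intro i hi
    refine (le_abs_self _).trans ?_
    exact Finset.single_le_sum (f := fun i => |A (i + 1) + D (i + 1)|)
      (fun i _ => abs_nonneg _) (mem_range.2 hi)
  obtain ⟨M, hM0, hM⟩ := hM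
  refine (finite_box n ((n + 1) * ((n + 1) * M))).subset ?_
  intro k hk
  exact wt_bound hM0 hM hk

lemma wt_summable (q r : ℝ) (n : ℕ) (D A : ℕ → ℤ) : Summable (wt q r n D A) :=
  summable_of_hasFiniteSupport (wt_finite q r n D A)

/-- The new charge vector in the second Pascal term. -/
def nv (A : ℕ → ℤ) (j : ℕ) : ℕ → ℤ := fun i => A i - 2 * ev (j + 1) i + ev j i + ev (j + 2) i

lemma wE_step1 (n j : ℕ) (hj : j ≤ n) (A k : ℕ → ℤ) :
    wE n (fun i => A i - 2 * ev (j + 1) i) k = wE n A k + 4 * k (j + 1) := by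
  have : 4 * k (j + 1) = ∑ i ∈ range (n + 1), if i = j then 4 * k (j + 1) else 0 := by
    rw [Finset.sum_ite_eq', if_pos (by simp; omega)]
  rw [this]
  unfold wE
  rw [← Finset.sum_add_distrib]
  refine Finset.sum_congr rfl fun i _ => ?_
  by_cases h : i = j
  · subst h; simp [ev]; ring
  · simp [ev, h]

lemma wE_step2 (n j : ℕ) (hj : j < n) (A k : ℕ → ℤ) (hk : k 0 = 0) :
    wE n (nv A j) (fun i => k i - ev (j + 1) i) + (2 - 2 * A (j + 1)) = wE n A k := by
  have e1 : ∀ X : ℤ, X = ∑ i ∈ range (n + 1), if i = j then X else 0 := by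
    intro X
    rw [Finset.sum_ite_eq', if_pos (by simp; omega)]
  have e2 : k j = ∑ i ∈ range (n + 1), if i + 1 = j then k j else 0 := by
    rcases j with _ | j
    · simp [hk]
    · simp only [Nat.add_right_cancel_iff]
      rw [Finset.sum_ite_eq', if_pos (by simp; omega)]
  have e3 : k (j + 2) = ∑ i ∈ range (n + 1), if i = j + 1 then k (j + 2) else 0 := by
    rw [Finset.sum_ite_eq', if_pos (by simp; omega)]
  have e4 : 2 - 2 * A (j + 1) = ∑ i ∈ range (n + 1),
      ((if i = j then (2 - k j - k (j + 2) - 2 * A (j + 1)) else 0)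
        + (if i + 1 = j then k j else 0) + (if i = j + 1 then k (j + 2) else 0)) := by
    rw [Finset.sum_add_distrib, Finset.sum_add_distrib, ← e1, ← e2, ← e3]; ring
  rw [e4]
  unfold wE
  rw [← Finset.sum_add_distrib]
  refine Finset.sum_congr rfl fun i _ => ?_
  unfold nv
  by_cases h : i = j
  · subst h; simp [ev]; ring
  · by_cases h2 : i + 1 = j
    · subst h2; simp [ev, show i ≠ i + 1 + 1 by omega]; ring
    · by_cases h3 : i = j + 1
      · subst h3; simp [ev, show j + 1 + 1 ≠ j by omega]; ring
      · simp [ev, h, h2, h3, show i + 2 ≠ j + 1 by omega]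

lemma wt_step {q r : ℝ} (h0 : 0 < q) (h1 : q < 1) (hr0 : 0 < r) (hr : q = r ^ 4)
    (n j : ℕ) (hj : j < n) (D A k : ℕ → ℤ) (hU : 1 ≤ A (j + 1) + D (j + 1)) :
    wt q r n D A k = wt q r n D (fun i => A i - 2 * ev (j + 1) i) k
      + r ^ (2 - 2 * A (j + 1)) * wt q r n D (nv A j) (fun i => k i - ev (j + 1) i) := by
  by_cases hc : k 0 = 0 ∧ ∀ i, n < i → k i = 0
  swap
  · have hc' : ¬ ((fun i => k i - ev (j + 1) i) 0 = 0 ∧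
        ∀ i, n < i → (fun i => k i - ev (j + 1) i) i = 0) := by
      contrapose! hc
      refine ⟨by simpa [ev] using hc.1, fun i hi => ?_⟩
      have := hc.2 i hi
      simpa [ev, show i ≠ j + 1 by omega] using this
    unfold wt
    rw [if_neg hc, if_neg hc, if_neg hc']; simp
  have hc' : ((fun i => k i - ev (j + 1) i) 0 = 0 ∧
        ∀ i, n < i → (fun i => k i - ev (j + 1) i) i = 0) := by
    refine ⟨by simpa [ev] using hc.1, fun i hi => ?_⟩
    have := hc.2 i hi
    simpa [ev, show i ≠ j + 1 by omega] using this
  unfold wt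
  rw [if_pos hc, if_pos hc, if_pos hc']
  rw [wE_step1 n j hj.le, ← wE_step2 n j hj A k hc.1, mul_left_comm, ← mul_assoc,
    ← zpow_add₀ hr0.ne']
  rw [zpow_add₀ hr0.ne' _ (4 * k (j + 1)), mul_assoc, ← mul_add]
  congr 1
  by_cases hneg : ∃ i ∈ range (n + 1), i ≠ j ∧ k (i + 1) < 0
  · obtain ⟨i, hi, hij, hk⟩ := hneg
    have z : ∀ U, wP q n U k = 0 := fun U => Finset.prod_eq_zero hi (hb_of_neg hk)
    have z2 : ∀ U, wP q n U (fun i => k i - ev (j + 1) i) = 0 := fun U =>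
      Finset.prod_eq_zero hi (hb_of_neg (by simpa [ev, hij] using hk))
    rw [z, z, z2]; simp
  push Not at hneg
  have hjm : j ∈ range (n + 1) := by simp; omega
  have hkj : 0 ≤ k j := by
    rcases j with _ | j
    · exact hc.1.ge
    · exact hneg j (by simp; omega) (by omega)
  have hkj2 : 0 ≤ k (j + 2) := hneg (j + 1) (by simp; omega) (by omega)
  unfold wP
  rw [← Finset.mul_prod_erase _ _ hjm, ← Finset.mul_prod_erase _ _ hjm,
    ← Finset.mul_prod_erase _ _ hjm]
  rw [hb_pascal h0 h1 (by linarith), add_mul]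
  have hq : q ^ (k (j + 1)) = r ^ (4 * k (j + 1)) := by
    rw [hr, ← zpow_natCast, ← zpow_mul]; norm_cast
  congr 1
  · rw [hq, ← mul_assoc]
    congr 1
    · simp [ev]; left; congr 1; ring
    · refine Finset.prod_congr rfl fun i hi => ?_
      have : i ≠ j := (Finset.mem_erase.1 hi).1
      simp [ev, this]
  · congr 1
    · simp [ev, nv]; congr 1; ring
    · refine Finset.prod_congr rfl fun i hi => ?_
      have hij : i ≠ j := (Finset.mem_erase.1 hi).1
      simp only [nv, ev]
      congr 1
      · by_cases h2 : i + 1 = j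
        · subst h2; simp [show i ≠ i + 1 + 1 by omega]; ring
        · by_cases h3 : i = j + 1
          · subst h3; simp [show j + 1 + 1 ≠ j by omega]; ring
          · simp [hij, h2, h3]
      · simp [hij]

lemma Zf_step {q r : ℝ} (h0 : 0 < q) (h1 : q < 1) (hr0 : 0 < r) (hr : q = r ^ 4)
    (n j : ℕ) (hj : j < n) (D A : ℕ → ℤ) (hU : 1 ≤ A (j + 1) + D (j + 1)) :
    Zf q r n D A = Zf q r n D (fun i => A i - 2 * ev (j + 1) i)
      + r ^ (2 - 2 * A (j + 1)) * Zf q r n D (nv A j) := by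
  unfold Zf
  rw [tsum_congr fun k => wt_step h0 h1 hr0 hr n j hj D A k hU]
  have e := (Equiv.subRight (ev (j + 1))).tsum_eq (wt q r n D (nv A j))
  have hf : (fun k : ℕ → ℤ => wt q r n D (nv A j) (fun i => k i - ev (j + 1) i))
      = fun k => wt q r n D (nv A j) (Equiv.subRight (ev (j + 1)) k) := by
    funext k
    congr 1
  have s : Summable fun k : ℕ → ℤ => wt q r n D (nv A j) (fun i => k i - ev (j + 1) i) := by
    rw [hf]
    exact (Equiv.summable_iff (f := wt q r n D (nv A j)) (Equiv.subRight (ev (j + 1)))).2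
      (wt_summable q r n D (nv A j))
  rw [Summable.tsum_add (wt_summable _ _ _ _ _) (s.mul_left _), tsum_mul_left, hf, e]

lemma Zf_last {q r : ℝ} (h0 : 0 < q) (h1 : q < 1)
    (n : ℕ) (D A : ℕ → ℤ) (hU : 1 ≤ A (n + 1) + D (n + 1)) :
    Zf q r n D A = Zf q r n D (fun i => A i - 2 * ev (n + 1) i) := by
  unfold Zf
  refine tsum_congr fun k => ?_
  by_cases hc : k 0 = 0 ∧ ∀ i, n < i → k i = 0
  swap
  · unfold wt
    rw [if_neg hc, if_neg hc]
  unfold wt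
  rw [if_pos hc, if_pos hc, wE_step1 n n le_rfl, hc.2 (n + 1) (by omega), mul_zero, add_zero]
  congr 1
  unfold wP
  rw [Finset.prod_range_succ, Finset.prod_range_succ]
  have e : ∀ i ∈ range n, hb q (k i + k (i + 2) + (A (i + 1) + D (i + 1))) (k (i + 1))
      = hb q (k i + k (i + 2) + (A (i + 1) - 2 * ev (n + 1) (i + 1) + D (i + 1))) (k (i + 1)) := by
    intro i hi
    rw [mem_range] at hi
    simp [ev, show i ≠ n by omega]
  rw [Finset.prod_congr rfl e]
  by_cases hneg : k n < 0
  · rcases n with _ | n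
    · rw [hc.1] at hneg; omega
    · rw [Finset.prod_eq_zero (i := n) (by simp) (hb_of_neg hneg)]; simp
  congr 1
  rw [hc.2 (n + 1) (by omega), hc.2 (n + 2) (by omega)]
  rw [hb_pascal h0 h1 (by beta_reduce; omega), hb_of_neg (m := (0 : ℤ) - 1) (by omega)]
  simp [ev]; congr 1; ring

/-- The charge vector `N e_1 + e_c`. -/
def Av (N : ℤ) (c : ℕ) : ℕ → ℤ := fun i => N * ev 1 i + ev c i

lemma Zrec1 {q r : ℝ} (h0 : 0 < q) (h1 : q < 1) (hr0 : 0 < r) (hr : q = r ^ 4)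
    (n : ℕ) (hn : 1 ≤ n) (D : ℕ → ℤ) (hD : ∀ i, 0 ≤ D i) (N : ℤ) (hN : 0 ≤ N) :
    Zf q r n D (Av N 1) = Zf q r n D (Av (N - 2) 1) + r ^ (-2 * N) * Zf q r n D (Av (N - 1) 2) := by
  rw [Zf_step h0 h1 hr0 hr n 0 (by omega) D _ (by have := hD 1; simp [Av, ev]; omega)]
  congr 1
  · apply Zf_congr
    intro i _ _
    simp only [Av, ev]; ring
  · congr 1
    · congr 1; simp [Av, ev]; ring
    · apply Zf_congr
      intro i hi _
      simp only [Av, ev, nv, show i ≠ 0 by omega, if_false, zero_add]; ring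

section tele
variable (q r : ℝ) (n : ℕ) (D : ℕ → ℤ) (N : ℤ) (c : ℕ)

def PP (i : ℕ) : ℝ := Zf q r n D (fun l => (N - 1) * ev 1 l - ev (i + 1) l + ev (i + 2) l + ev c l)
def YY (i : ℕ) : ℝ := Zf q r n D (fun l => (N - 1) * ev 1 l - ev (i + 1) l - ev (i + 2) l + ev c l)
def QQ : ℕ → ℝ
  | 0 => r ^ (2 - 2 * N) * Zf q r n D (Av (N - 2) c)
  | i + 1 => Zf q r n D (fun l => (N - 1) * ev 1 l + ev (i + 1) l - ev (i + 2) l + ev c l)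
end tele

lemma PP_step {q r : ℝ} (h0 : 0 < q) (h1 : q < 1) (hr0 : 0 < r) (hr : q = r ^ 4)
    (n : ℕ) (D : ℕ → ℤ) (hD : ∀ i, 0 ≤ D i) (N : ℤ) (c i : ℕ) (hi : i + 3 ≤ c)
    (hc : c ≤ n + 1) : PP q r n D N c i = YY q r n D N c i + PP q r n D N c (i + 1) := by
  unfold PP YY
  rw [Zf_step h0 h1 hr0 hr n (i + 1) (by omega) D _
    (by have := hD (i + 1 + 1); simp [ev, show i + 1 + 1 ≠ c by omega]; omega)]
  congr 1
  · apply Zf_congr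
    intro l _ _
    simp only [ev]; ring
  · have : Zf q r n D (nv (fun l => (N - 1) * ev 1 l - ev (i + 1) l + ev (i + 2) l + ev c l) (i + 1))
      = Zf q r n D (fun l => (N - 1) * ev 1 l - ev (i + 1 + 1) l + ev (i + 1 + 2) l + ev c l) := by
      apply Zf_congr
      intro l _ _
      simp only [nv, ev]; ring
    rw [this]
    simp [ev, show i + 1 + 1 ≠ c by omega]

lemma QQ_step {q r : ℝ} (h0 : 0 < q) (h1 : q < 1) (hr0 : 0 < r) (hr : q = r ^ 4)
    (n : ℕ) (D : ℕ → ℤ) (hD : ∀ i, 0 ≤ D i) (N : ℤ) (hN : 1 ≤ N) (c i : ℕ) (hi : i + 2 ≤ c)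
    (hc : c ≤ n + 1) : QQ q r n D N c (i + 1) = YY q r n D N c i + QQ q r n D N c i := by
  have e1 := Zf_step h0 h1 hr0 hr n i (by omega) D
    (fun l => (N - 1) * ev 1 l + ev (i + 1) l - ev (i + 2) l + ev c l)
    (by
      have := hD (i + 1)
      rcases i with _ | i
      · have := hD 1
        simp [ev, show 1 ≠ c by omega]; omega
      · simp [ev, show i + 1 + 1 ≠ c by omega]; omega)
  rw [show QQ q r n D N c (i + 1) = Zf q r n D (fun l => (N - 1) * ev 1 l + ev (i + 1) l - ev (i + 2) l + ev c l) from rfl, e1]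
  congr 1
  · apply Zf_congr
    intro l _ _
    simp only [ev]; ring
  · rcases i with _ | i
    · unfold QQ
      congr 1
      · simp [ev, show 1 ≠ c by omega]
      · apply Zf_congr
        intro l hl _
        simp only [nv, ev, Av, show l ≠ 0 by omega, if_false, zero_add]; ring
    · unfold QQ
      have : Zf q r n D (nv (fun l => (N - 1) * ev 1 l + ev (i + 1 + 1) l - ev (i + 1 + 2) l + ev c l) (i + 1))
        = Zf q r n D (fun l => (N - 1) * ev 1 l + ev (i + 1) l - ev (i + 2) l + ev c l) := by
        apply Zf_congr
        intro l _ _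
        simp only [nv, ev]; ring
      rw [this]
      simp [ev, show i + 1 + 1 ≠ c by omega]

/-- The value beyond the last site is zero. -/
def Zx (q r : ℝ) (n : ℕ) (D : ℕ → ℤ) (N : ℤ) (c : ℕ) : ℝ :=
  if c ≤ n + 1 then Zf q r n D (Av N c) else 0

lemma PP_end {q r : ℝ} (h0 : 0 < q) (h1 : q < 1) (hr0 : 0 < r) (hr : q = r ^ 4)
    (n : ℕ) (D : ℕ → ℤ) (hD : ∀ i, 0 ≤ D i) (N : ℤ) (i : ℕ)
    (hc : i + 2 ≤ n + 1) :
    PP q r n D N (i + 2) i = YY q r n D N (i + 2) i + r ^ (-2 : ℤ) * Zx q r n D (N - 1) (i + 3) := by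
  have hU : (1 : ℤ) ≤ (fun l => (N - 1) * ev 1 l - ev (i + 1) l + ev (i + 2) l + ev (i + 2) l) (i + 1 + 1)
      + D (i + 1 + 1) := by
    have := hD (i + 1 + 1); simp [ev]; omega
  unfold PP YY Zx
  by_cases h : i + 3 ≤ n + 1
  · rw [if_pos h, Zf_step h0 h1 hr0 hr n (i + 1) (by omega) D _ hU]
    congr 1
    · apply Zf_congr
      intro l _ _
      simp only [ev]; ring
    · congr 1
      · simp [ev]
      · apply Zf_congr
        intro l _ _
        simp only [nv, ev, Av]; ring
  · rw [if_neg h, mul_zero, add_zero]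
    obtain rfl : n = i + 1 := by omega
    rw [Zf_last h0 h1 (i + 1) D _ hU]
    apply Zf_congr
    intro l _ _
    simp only [ev]; ring

lemma Zrec {q r : ℝ} (h0 : 0 < q) (h1 : q < 1) (hr0 : 0 < r) (hr : q = r ^ 4)
    (n : ℕ) (hn : 1 ≤ n) (D : ℕ → ℤ) (hD : ∀ i, 0 ≤ D i) (N : ℤ) (hN : 1 ≤ N) (i : ℕ)
    (hc : i + 2 ≤ n + 1) :
    Zf q r n D (Av N (i + 2)) = Zf q r n D (Av (N - 2) (i + 2)) + r ^ (2 - 2 * N) *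
      (r ^ (-2 : ℤ) * Zx q r n D (N - 1) (i + 3) + Zf q r n D (Av (N - 1) (i + 1))
        - r ^ (2 - 2 * N) * Zf q r n D (Av (N - 2) (i + 2))) := by
  have cons : ∀ j, j ≤ i → PP q r n D N (i + 2) 0 + QQ q r n D N (i + 2) 0
      = PP q r n D N (i + 2) j + QQ q r n D N (i + 2) j := by
    intro j
    induction j with
    | zero => intro _; rfl
    | succ j ih =>
      intro hj
      rw [ih (by omega), PP_step h0 h1 hr0 hr n D hD N (i + 2) j (by omega) hc,
        QQ_step h0 h1 hr0 hr n D hD N hN (i + 2) j (by omega) hc]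
      ring
  have e1 := cons i le_rfl
  have e2 := PP_end h0 h1 hr0 hr n D hD N i hc
  have e3 := QQ_step h0 h1 hr0 hr n D hD N hN (i + 2) i le_rfl hc
  have e4 : QQ q r n D N (i + 2) (i + 1) = Zf q r n D (Av (N - 1) (i + 1)) := by
    unfold QQ
    apply Zf_congr
    intro l _ _
    simp only [ev, Av]; ring
  have e5 : QQ q r n D N (i + 2) 0 = r ^ (2 - 2 * N) * Zf q r n D (Av (N - 2) (i + 2)) := rfl
  have e6 : Zf q r n D (Av N (i + 2)) = Zf q r n D (Av (N - 2) (i + 2))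
      + r ^ (2 - 2 * N) * PP q r n D N (i + 2) 0 := by
    rw [Zf_step h0 h1 hr0 hr n 0 (by omega) D _ (by have := hD 1; simp [Av, ev]; omega)]
    congr 1
    · apply Zf_congr
      intro l _ _
      simp only [Av, ev]; ring
    · congr 1
      · simp [Av, ev]
      · apply Zf_congr
        intro l hl _
        simp only [Av, ev, nv, show l ≠ 0 by omega, if_false, zero_add]; ring
  rw [e6]
  congr 2
  rw [← e5]
  linarith

/-- Normalized increments. -/
def ee (n c a' : ℕ) (x : ℕ → ℤ) (i : ℕ) : ℤ :=
  x (i + 1) - x i + (if c ≤ i then 1 else 0) + (if a' ≤ i then 1 else 0)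
    + (if n + 1 ≤ i then 1 else 0)

lemma ee_mono (n c a' : ℕ) (x : ℕ → ℤ)
    (h : ∀ i, i ≤ n → (x i + x (i + 2) + (ev c (i + 1) + ev a' (i + 1) + ev (n + 1) (i + 1))) % 2 = 0 ∧
      2 * x (i + 1) ≤ x i + x (i + 2) + (ev c (i + 1) + ev a' (i + 1) + ev (n + 1) (i + 1))) (i j : ℕ)
    (hij : i ≤ j) (hj : j ≤ n + 1) :
    ee n c a' x i ≤ ee n c a' x j ∧ (ee n c a' x j - ee n c a' x i) % 2 = 0 := by
  induction j, hij using Nat.le_induction with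
  | base => simp
  | succ j hj1 ih =>
    have e1 := ih (by omega)
    have e2 := h j (by omega)
    have e3 : ee n c a' x j ≤ ee n c a' x (j + 1) ∧
        (ee n c a' x (j + 1) - ee n c a' x j) % 2 = 0 := by
      unfold ee
      simp only [ev] at e2
      have i1 : (if c ≤ j + 1 then (1 : ℤ) else 0)
        = (if c ≤ j then 1 else 0) + (if j + 1 = c then 1 else 0) := by
        split_ifs <;> omega
      have i2 : (if a' ≤ j + 1 then (1 : ℤ) else 0)
        = (if a' ≤ j then 1 else 0) + (if j + 1 = a' then 1 else 0) := by
        split_ifs <;> omega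
      have i3 : (if n + 1 ≤ j + 1 then (1 : ℤ) else 0)
        = (if n + 1 ≤ j then 1 else 0) + (if j + 1 = n + 1 then 1 else 0) := by
        split_ifs <;> omega
      rw [i1, i2, i3]
      generalize (if c ≤ j then (1 : ℤ) else 0) = t1 at *
      generalize (if a' ≤ j then (1 : ℤ) else 0) = t2 at *
      generalize (if n + 1 ≤ j then (1 : ℤ) else 0) = t3 at *
      generalize (if j + 1 = c then (1 : ℤ) else 0) = s1 at *
      generalize (if j + 1 = a' then (1 : ℤ) else 0) = s2 at *
      generalize (if j + 1 = n + 1 then (1 : ℤ) else 0) = s3 at *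
      rw [show j + 1 + 1 = j + 2 from rfl]
      omega
    omega

/-- Basic constraints for a nonzero configuration. -/
lemma ee_facts (n c a' : ℕ) (hc : c ≤ n + 1) (ha : a' ≤ n + 1) (ha1 : 1 ≤ a') (x : ℕ → ℤ)
    (h : ∀ i, i ≤ n → (x i + x (i + 2) + (ev c (i + 1) + ev a' (i + 1) + ev (n + 1) (i + 1))) % 2 = 0 ∧
      2 * x (i + 1) ≤ x i + x (i + 2) + (ev c (i + 1) + ev a' (i + 1) + ev (n + 1) (i + 1)))
    (h0 : 0 ≤ x 0) (hn1 : x (n + 1) = 0) (hn2 : x (n + 2) = 0) :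
    (∀ i, i ≤ n + 1 → ee n c a' x i % 2 = 1) ∧ x 1 - x 0 + (if c ≤ 0 then 1 else 0) ≤ 1 := by
  have hm := ee_mono n c a' x h
  have e3 : ee n c a' x (n + 1) = 3 := by
    unfold ee
    rw [if_pos hc, if_pos ha, if_pos le_rfl, hn1, show n + 1 + 1 = n + 2 from rfl, hn2]; norm_num
  have hp : ∀ i, i ≤ n + 1 → ee n c a' x i % 2 = 1 := by
    intro i hi
    have := (hm i (n + 1) hi le_rfl).2
    omega
  refine ⟨hp, ?_⟩
  have e0 : ee n c a' x 0 = x 1 - x 0 + (if c ≤ 0 then 1 else 0) := by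
    unfold ee
    rw [if_neg (show ¬ a' ≤ 0 by omega), if_neg (show ¬ n + 1 ≤ 0 by omega)]; simp
  rw [← e0]
  by_contra hcon
  have p0 := hp 0 (by omega)
  have hinc : ∀ i, i ≤ n → x i + 1 ≤ x (i + 1) := by
    intro i hi
    have := (hm 0 i (by omega) (by omega)).1
    unfold ee at this hcon p0
    rw [if_neg (show ¬ n + 1 ≤ i by omega)] at this
    split_ifs at * <;> omega
  have := incr_pos x 0 n (by omega) (by have := hinc 0 (by omega); omega)
    (fun j _ hj => by have := hinc j hj; omega)
  omega

/-- The charge `D`. -/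
def Dv (n a' : ℕ) : ℕ → ℤ := fun i => ev a' i + ev (n + 1) i

lemma Dv_nonneg (n a' i : ℕ) : 0 ≤ Dv n a' i := by
  unfold Dv ev; split_ifs <;> norm_num

lemma wt_cons {q r : ℝ} {n c a' : ℕ} {N : ℤ} {k : ℕ → ℤ}
    (h : wt q r n (Dv n a') (Av N c) k ≠ 0) (x : ℕ → ℤ) (hx : x = fun i => if i = 0 then N else k i) :
    (∀ i, i ≤ n → (x i + x (i + 2) + (ev c (i + 1) + ev a' (i + 1) + ev (n + 1) (i + 1))) % 2 = 0 ∧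
      2 * x (i + 1) ≤ x i + x (i + 2) + (ev c (i + 1) + ev a' (i + 1) + ev (n + 1) (i + 1))) ∧
    x (n + 1) = 0 ∧ x (n + 2) = 0 := by
  obtain ⟨h0, h1, h2⟩ := wt_ne_zero h
  refine ⟨fun i hi => ?_, ?_, ?_⟩
  · have := h2 i hi
    unfold Av Dv at this
    subst hx
    rcases i with _ | i
    · have e : ev 1 1 = 1 := by simp [ev]
      simp only [zero_add, e, h0] at this
      simp
      omega
    · have e : ev 1 (i + 1 + 1) = 0 := by simp [ev]
      simp only [e] at this
      simp
      omega
  · subst hx; simp; exact h1 _ (by omega)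
  · subst hx; simp; exact h1 _ (by omega)

/-- Bound and parity of the first component and parity of `N`. -/
lemma wt_first {q r : ℝ} {n c a' : ℕ} (hc : c ≤ n + 1) (hc1 : 1 ≤ c) (ha : a' ≤ n + 1) (ha1 : 1 ≤ a')
    {N : ℤ} (hN : 0 ≤ N) {k : ℕ → ℤ}
    (h : wt q r n (Dv n a') (Av N c) k ≠ 0) :
    0 ≤ k 1 ∧ k 1 ≤ N + 1 ∧ (k 1 - N) % 2 = 1 ∧ (N + (n + 1) + c + a') % 2 = 0 := by
  obtain ⟨x, hxd⟩ : ∃ x : ℕ → ℤ, x = fun i => if i = 0 then N else k i := ⟨_, rfl⟩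
  obtain ⟨hx, hx1, hx2⟩ := wt_cons h x hxd
  have x0 : x 0 = N := by simp [hxd]
  have x1 : x 1 = k 1 := by simp [hxd]
  obtain ⟨hp, hD⟩ := ee_facts n c a' hc ha ha1 x hx (by rw [x0]; exact hN) hx1 hx2
  rw [if_neg (by omega), x0, x1] at hD
  have p0 := hp 0 (by omega)
  unfold ee at p0
  rw [if_neg (show ¬ c ≤ 0 by omega), if_neg (show ¬ a' ≤ 0 by omega),
    if_neg (show ¬ n + 1 ≤ 0 by omega), zero_add, x0, x1] at p0
  have hk1 := ((wt_ne_zero h).2.2 0 (by omega)).2.1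
  have hpar : ∀ i, i ≤ n + 1 → (x i - (N + i + (i - c : ℕ) + (i - a' : ℕ))) % 2 = 0 := by
    intro i
    induction i with
    | zero => intro _; rw [x0]; simp
    | succ i ih =>
      intro hi
      have e1 := ih (by omega)
      have e2 := hp i (by omega)
      unfold ee at e2
      rw [if_neg (show ¬ n + 1 ≤ i by omega)] at e2
      push_cast
      split_ifs at e2 <;> omega
  have e := hpar (n + 1) le_rfl
  rw [hx1] at e
  refine ⟨by simpa using hk1, by omega, by omega, by omega⟩

/-- The unique ground configuration. -/
def gk (c a' i : ℕ) : ℤ := (i : ℤ) - (i - c : ℕ) - (i - a' : ℕ)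

lemma wt_uniq {q r : ℝ} {n c a' : ℕ} (hc : c ≤ n + 1) (ha : a' ≤ n + 1) (ha1 : 1 ≤ a')
    {k : ℕ → ℤ} (h : wt q r n (Dv n a') (Av 0 c) k ≠ 0) :
    c + a' = n + 1 ∧ ∀ i, k i = if i ≤ n then gk c a' i else 0 := by
  obtain ⟨w0, w1, w2⟩ := wt_ne_zero h
  have hxk : (fun i => if i = 0 then 0 else k i) = k := by
    funext i; split_ifs with hi
    · rw [hi, w0]
    · rfl
  obtain ⟨hx, hx1, hx2⟩ := wt_cons h k hxk.symm
  obtain ⟨hp, hD⟩ := ee_facts n c a' hc ha ha1 k hx w0.ge hx1 hx2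
  have hm := ee_mono n c a' k hx
  have p0 := hp 0 (by omega)
  have hk1 := (w2 0 (by omega)).2.1
  have hkn : 0 ≤ k n := by
    rcases n with _ | n
    · rw [w0]
    · exact (w2 n (by omega)).2.1
  have e0 : ee n c a' k 0 = 1 := by
    unfold ee at p0 ⊢
    rw [if_neg (show ¬ a' ≤ 0 by omega), if_neg (show ¬ n + 1 ≤ 0 by omega)] at p0 ⊢
    rw [zero_add] at *
    rw [w0] at *
    split_ifs at * <;> omega
  have en : ee n c a' k n ≤ 2 := by
    unfold ee
    rw [hx1, if_neg (show ¬ n + 1 ≤ n by omega)]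
    split_ifs <;> omega
  have eall : ∀ i, i ≤ n → ee n c a' k i = 1 := by
    intro i hi
    have a1 := (hm 0 i (by omega) (by omega)).1
    have a2 := (hm i n (by omega) (by omega)).1
    have a3 := hp i (by omega)
    omega
  have hk : ∀ i, i ≤ n + 1 → k i = gk c a' i := by
    intro i
    induction i with
    | zero => intro _; rw [w0]; simp [gk]
    | succ i ih =>
      intro hi
      have e1 := ih (by omega)
      have e2 := eall i (by omega)
      unfold ee at e2
      rw [if_neg (show ¬ n + 1 ≤ i by omega)] at e2
      unfold gk at *
      push_cast
      split_ifs at e2 <;> omega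
  constructor
  · have := hk (n + 1) le_rfl
    rw [hx1] at this
    unfold gk at this
    omega
  · intro i
    split_ifs with hi
    · exact hk i (by omega)
    · exact w1 i (by omega)

lemma hb_double {q : ℝ} (h0 : 0 < q) (h1 : q < 1) {t m : ℤ} (ht : t = 2 * m) (hm : 0 ≤ m) :
    hb q t m = 1 := by
  unfold hb
  rw [if_pos (by omega), show t / 2 = m by omega, gb_self h0 h1 hm]

lemma gk_nonneg {n c a' i : ℕ} (h : c + a' = n + 1) (hi : i ≤ n + 1) : 0 ≤ gk c a' i := by
  unfold gk; omega

lemma gk_last {n c a' : ℕ} (h : c + a' = n + 1) : gk c a' (n + 1) = 0 := by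
  unfold gk; omega

lemma gk_diff (c a' i : ℕ) (ha : 1 ≤ a') :
    2 * gk c a' (i + 1) - gk c a' i - gk c a' (i + 2) = ev c (i + 1) + ev a' (i + 1) := by
  unfold gk ev
  push_cast
  split_ifs <;> omega

lemma wt_ground {q r : ℝ} (h0 : 0 < q) (h1 : q < 1) {n c a' : ℕ} (hn : 1 ≤ n) (h : c + a' = n + 1) (ha1 : 1 ≤ a') :
    wt q r n (Dv n a') (Av 0 c) (fun i => if i ≤ n then gk c a' i else 0) = 1 := by
  set K : ℕ → ℤ := fun i => if i ≤ n then gk c a' i else 0 with hK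
  have K1 : ∀ i, i ≤ n + 1 → K i = gk c a' i := by
    intro i hi
    simp only [hK]
    split_ifs with h2
    · rfl
    · rw [show i = n + 1 by omega, gk_last h]
  have K2 : ∀ i, n < i → K i = 0 := by
    intro i hi
    simp only [hK]; rw [if_neg (by omega)]
  unfold wt
  rw [if_pos ⟨by rw [K1 0 (by omega)]; simp [gk], K2⟩]
  have hE : wE n (Av 0 c) K = 0 := by
    unfold wE
    rw [Finset.sum_range_succ, K2 (n + 1) (by omega), zero_mul, add_zero]
    have : ∀ i ∈ range n, K (i + 1) * (2 * K (i + 1) - K i - K (i + 2) - 2 * Av 0 c (i + 1))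
        = (if i + 1 = a' then gk c a' a' else 0) - (if i + 1 = c then gk c a' c else 0) := by
      intro i hi
      rw [mem_range] at hi
      rw [K1 _ (by omega), K1 _ (by omega), K1 _ (by omega), gk_diff c a' i ha1]
      unfold Av ev
      split_ifs with h1 h2 h3 <;> simp_all
    rw [Finset.sum_congr rfl this, Finset.sum_sub_distrib]
    have aux : ∀ d : ℕ, d ≤ n → ∑ i ∈ range n, (if i + 1 = d then gk c a' d else 0) = gk c a' d := by
      intro d hd
      rcases d with _ | d
      · simp [gk]
      · rw [Finset.sum_eq_single d]
        · simp
        · intro i _ hi; rw [if_neg (by omega)]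
        · intro hd2; simp at hd2; omega
    by_cases hc : c = 0
    · have hs : ∀ d, c = 0 → ∑ i ∈ range n, (if i + 1 = d then gk c a' d else 0) = 0 := by
        intro d _
        apply Finset.sum_eq_zero
        intro i hi
        split_ifs
        · rw [mem_range] at hi; unfold gk; omega
        · rfl
      rw [hs _ hc, hs _ hc]; rfl
    · rw [aux _ (by omega), aux _ (by omega)]
      unfold gk; omega
  rw [hE, zpow_zero, one_mul]
  unfold wP
  apply Finset.prod_eq_one
  intro i hi
  rw [mem_range] at hi
  by_cases hin : i = n
  · subst hin
    rw [K2 (i + 1) (by omega), K2 (i + 2) (by omega), K1 i (by omega)]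
    unfold hb gk Av Dv ev
    beta_reduce
    split_ifs with g g1 g2 g3 g4 g5 <;> first | omega | skip
    all_goals (first | (apply gb_zero_right h0 h1; omega) | skip)
  · have e := gk_diff c a' i ha1
    apply hb_double h0 h1
    · rw [K1 _ (by omega), K1 _ (by omega), K1 _ (by omega)]
      have : ev (n + 1) (i + 1) = 0 := by simp [ev, hin]
      simp only [Av, Dv, this]
      linarith
    · rw [K1 _ (by omega)]; exact gk_nonneg h (by omega)

lemma Z0 {q r : ℝ} (h0 : 0 < q) (h1 : q < 1) {n c a' : ℕ} (hn : 1 ≤ n) (hc : c ≤ n + 1)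
    (ha : a' ≤ n + 1) (ha1 : 1 ≤ a') :
    Zf q r n (Dv n a') (Av 0 c) = if c + a' = n + 1 then 1 else 0 := by
  unfold Zf
  split_ifs with h
  · rw [tsum_eq_single (fun i => if i ≤ n then gk c a' i else 0), wt_ground h0 h1 hn h ha1]
    intro k hk
    by_contra hne
    exact hk (funext (wt_uniq hc ha ha1 hne).2)
  · have : ∀ k, wt q r n (Dv n a') (Av 0 c) k = 0 := by
      intro k
      by_contra hne
      exact h (wt_uniq hc ha ha1 hne).1
    simp [this]

/-- Term of the bosonic sum. -/
def St (q r : ℝ) (p a N b j : ℤ) : ℝ :=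
  r ^ (4 * (j * (p * j + a - p))) * bb q N (2 * p * j + a - b)
    - r ^ (4 * ((j + 1) * (p * j + a))) * bb q N (2 * p * j + a + b)

def S2t (q r : ℝ) (p a N b j : ℤ) : ℝ :=
  r ^ (4 * (p * j ^ 2 + j * a)) * bb q N (2 * p * j + a - b)
    - r ^ (4 * (p * j ^ 2 + j * a)) * bb q N (2 * p * j + a + b)

def SS (q r : ℝ) (p a N b : ℤ) : ℝ := ∑' j : ℤ, St q r p a N b j
def SS2 (q r : ℝ) (p a N b : ℤ) : ℝ := ∑' j : ℤ, S2t q r p a N b j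

lemma bb_summable (q : ℝ) (N p d : ℤ) (hp : 1 ≤ p) (f : ℤ → ℝ) :
    Summable fun j : ℤ => f j * bb q N (2 * p * j + d) := by
  apply summable_of_hasFiniteSupport
  refine (Set.finite_Icc (-(|N| + |d|)) (|N| + |d|)).subset ?_
  intro j hj
  have h := (bb_ne_zero (right_ne_zero_of_mul hj)).1
  rw [abs_le] at h
  have h1 := le_abs_self N
  have h2 := le_abs_self d
  have h3 := neg_abs_le d
  have h4 := abs_nonneg N
  have h5 := abs_nonneg d
  refine ⟨?_, ?_⟩
  · by_contra hc
    push Not at hc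
    nlinarith
  · by_contra hc
    push Not at hc
    nlinarith

lemma St_summable (q r : ℝ) (p a N b : ℤ) (hp : 1 ≤ p) : Summable (St q r p a N b) := by
  have e1 := bb_summable q N p (a - b) hp (fun j => r ^ (4 * (j * (p * j + a - p))))
  have e2 := bb_summable q N p (a + b) hp (fun j => r ^ (4 * ((j + 1) * (p * j + a))))
  refine (e1.sub e2).congr fun j => ?_
  unfold St
  rw [add_sub_assoc (2 * p * j), add_assoc (2 * p * j)]

lemma S2t_summable (q r : ℝ) (p a N b : ℤ) (hp : 1 ≤ p) : Summable (S2t q r p a N b) := by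
  have e1 := bb_summable q N p (a - b) hp (fun j => r ^ (4 * (p * j ^ 2 + j * a)))
  have e2 := bb_summable q N p (a + b) hp (fun j => r ^ (4 * (p * j ^ 2 + j * a)))
  refine (e1.sub e2).congr fun j => ?_
  unfold S2t
  rw [add_sub_assoc, add_assoc]

lemma SS_rec {q r : ℝ} (h0 : 0 < q) (h1 : q < 1) (hr0 : 0 < r) (hr : q = r ^ 4)
    (p a N b : ℤ) (hp : 1 ≤ p) (hN : 1 ≤ N) :
    SS q r p a N b = SS q r p a (N - 1) (b + 1)
      + r ^ (2 * (N + a - b)) * SS2 q r p a (N - 1) (b - 1) := by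
  unfold SS SS2
  rw [← tsum_mul_left, ← Summable.tsum_add (St_summable _ _ _ _ _ _ hp)
    ((S2t_summable _ _ _ _ _ _ hp).mul_left _)]
  refine tsum_congr fun j => ?_
  unfold St S2t
  rw [bb_pascal2 h0 h1 hr hN (2 * p * j + a - b), bb_pascal1 h0 h1 hr hN (2 * p * j + a + b),
    show 2 * p * j + a - b - 1 = 2 * p * j + a - (b + 1) by ring,
    show 2 * p * j + a - b + 1 = 2 * p * j + a - (b - 1) by ring,
    show 2 * p * j + a + b + 1 = 2 * p * j + a + (b + 1) by ring,
    show 2 * p * j + a + b - 1 = 2 * p * j + a + (b - 1) by ring]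
  have e1 : r ^ (4 * (j * (p * j + a - p))) * r ^ (2 * (N + (2 * p * j + a - b)))
      = r ^ (2 * (N + a - b)) * r ^ (4 * (p * j ^ 2 + j * a)) := by
    rw [← zpow_add₀ hr0.ne', ← zpow_add₀ hr0.ne']; congr 1; ring
  have e2 : r ^ (4 * ((j + 1) * (p * j + a))) * r ^ (2 * (N - (2 * p * j + a + b)))
      = r ^ (2 * (N + a - b)) * r ^ (4 * (p * j ^ 2 + j * a)) := by
    rw [← zpow_add₀ hr0.ne', ← zpow_add₀ hr0.ne']; congr 1; ring
  linear_combination (bb q (N - 1) (2 * p * j + a - (b - 1))) * e1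
    - (bb q (N - 1) (2 * p * j + a + (b - 1))) * e2

lemma SS2_rec {q r : ℝ} (h0 : 0 < q) (h1 : q < 1) (hr0 : 0 < r) (hr : q = r ^ 4)
    (p a N b : ℤ) (hp : 1 ≤ p) (hN : 1 ≤ N) :
    SS2 q r p a N b = SS2 q r p a (N - 1) (b - 1)
      + r ^ (2 * (N - a + b)) * SS q r p a (N - 1) (b + 1) := by
  unfold SS SS2
  rw [← tsum_mul_left, ← Summable.tsum_add (S2t_summable _ _ _ _ _ _ hp)
    ((St_summable _ _ _ _ _ _ hp).mul_left _)]
  refine tsum_congr fun j => ?_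
  unfold St S2t
  rw [bb_pascal1 h0 h1 hr hN (2 * p * j + a - b), bb_pascal2 h0 h1 hr hN (2 * p * j + a + b),
    show 2 * p * j + a - b - 1 = 2 * p * j + a - (b + 1) by ring,
    show 2 * p * j + a - b + 1 = 2 * p * j + a - (b - 1) by ring,
    show 2 * p * j + a + b + 1 = 2 * p * j + a + (b + 1) by ring,
    show 2 * p * j + a + b - 1 = 2 * p * j + a + (b - 1) by ring]
  have e1 : r ^ (4 * (p * j ^ 2 + j * a)) * r ^ (2 * (N - (2 * p * j + a - b)))
      = r ^ (2 * (N - a + b)) * r ^ (4 * (j * (p * j + a - p))) := by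
    rw [← zpow_add₀ hr0.ne', ← zpow_add₀ hr0.ne']; congr 1; ring
  have e2 : r ^ (4 * (p * j ^ 2 + j * a)) * r ^ (2 * (N + (2 * p * j + a + b)))
      = r ^ (2 * (N - a + b)) * r ^ (4 * ((j + 1) * (p * j + a))) := by
    rw [← zpow_add₀ hr0.ne', ← zpow_add₀ hr0.ne']; congr 1; ring
  linear_combination (bb q (N - 1) (2 * p * j + a - (b + 1))) * e1
    - (bb q (N - 1) (2 * p * j + a + (b + 1))) * e2

lemma SS_p (q r : ℝ) (p a N : ℤ) (hp : 1 ≤ p) : SS q r p a N p = 0 := by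
  unfold SS
  have e1 := bb_summable q N p (a - p) hp (fun j => r ^ (4 * (j * (p * j + a - p))))
  have e2 := bb_summable q N p (a + p) hp (fun j => r ^ (4 * ((j + 1) * (p * j + a))))
  have : ∀ j, St q r p a N p j = r ^ (4 * (j * (p * j + a - p))) * bb q N (2 * p * j + (a - p))
      - r ^ (4 * ((j + 1) * (p * j + a))) * bb q N (2 * p * j + (a + p)) := by
    intro j; unfold St; rw [add_sub_assoc (2 * p * j), add_assoc (2 * p * j)]
  rw [tsum_congr this, Summable.tsum_sub e1 e2]
  rw [← (Equiv.addRight (1 : ℤ)).tsum_eq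
    (fun j : ℤ => r ^ (4 * (j * (p * j + a - p))) * bb q N (2 * p * j + (a - p)))]
  rw [sub_eq_zero]
  refine tsum_congr fun j => ?_
  simp only [Equiv.coe_addRight]
  congr 2 <;> ring

lemma SS2_zero (q r : ℝ) (p a N : ℤ) : SS2 q r p a N 0 = 0 := by
  unfold SS2
  simp [S2t]

lemma bb_zero {q : ℝ} (h0 : 0 < q) (h1 : q < 1) (A : ℤ) : bb q 0 A = if A = 0 then 1 else 0 := by
  split_ifs with h
  · subst h; unfold bb; simp [gb_zero_right h0 h1]
  · by_contra hc
    have := (bb_ne_zero hc).1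
    have h2 := abs_nonneg A
    exact h (abs_eq_zero.1 (le_antisymm this h2))

lemma idx1 {p a b j : ℤ} (ha : 1 ≤ a) (ha2 : a < p) (hb : 0 ≤ b) (hb2 : b ≤ p) :
    2 * p * j + a - b = 0 ↔ j = 0 ∧ a = b := by
  constructor
  · intro h
    have : j = 0 := by
      by_contra hj
      rcases lt_or_gt_of_ne hj with hj | hj
      · nlinarith
      · nlinarith
    subst this
    exact ⟨rfl, by linarith⟩
  · rintro ⟨rfl, rfl⟩; ring

lemma idx2 {p a b j : ℤ} (ha : 1 ≤ a) (ha2 : a < p) (hb : 0 ≤ b) (hb2 : b ≤ p) :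
    2 * p * j + a + b ≠ 0 := by
  intro h
  rcases lt_or_ge j 0 with hj | hj
  · nlinarith
  · nlinarith

lemma SS_init {q r : ℝ} (h0 : 0 < q) (h1 : q < 1) (p a b : ℤ)
    (ha : 1 ≤ a) (ha2 : a < p) (hb : 0 ≤ b) (hb2 : b ≤ p) :
    SS q r p a 0 b = if a = b then 1 else 0 := by
  unfold SS
  rw [tsum_eq_single 0]
  · unfold St
    rw [bb_zero h0 h1, bb_zero h0 h1, if_neg (idx2 ha ha2 hb hb2)]
    simp only [idx1 ha ha2 hb hb2]
    simp
  · intro j hj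
    unfold St
    rw [bb_zero h0 h1, bb_zero h0 h1, if_neg (idx2 ha ha2 hb hb2)]
    simp only [idx1 ha ha2 hb hb2]
    simp [hj]

lemma SS2_init {q r : ℝ} (h0 : 0 < q) (h1 : q < 1) (p a b : ℤ)
    (ha : 1 ≤ a) (ha2 : a < p) (hb : 0 ≤ b) (hb2 : b ≤ p) :
    SS2 q r p a 0 b = if a = b then 1 else 0 := by
  unfold SS2
  rw [tsum_eq_single 0]
  · unfold S2t
    rw [bb_zero h0 h1, bb_zero h0 h1, if_neg (idx2 ha ha2 hb hb2)]
    simp only [idx1 ha ha2 hb hb2]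
    simp
  · intro j hj
    unfold S2t
    rw [bb_zero h0 h1, bb_zero h0 h1, if_neg (idx2 ha ha2 hb hb2)]
    simp only [idx1 ha ha2 hb hb2]
    simp [hj]

lemma SS_rec2 {q r : ℝ} (h0 : 0 < q) (h1 : q < 1) (hr0 : 0 < r) (hr : q = r ^ 4)
    (p a N b : ℤ) (hp : 1 ≤ p) (hN : 2 ≤ N) :
    SS q r p a N b = SS q r p a (N - 1) (b + 1) + SS q r p a (N - 1) (b - 1)
      + (r ^ (4 * N - 4) - 1) * SS q r p a (N - 2) b := by
  have e1 := SS_rec h0 h1 hr0 hr p a N b hp (by omega)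
  have e2 := SS_rec h0 h1 hr0 hr p a (N - 1) (b - 1) hp (by omega)
  have e3 := SS2_rec h0 h1 hr0 hr p a (N - 1) (b - 1) hp (by omega)
  rw [show N - 1 - 1 = N - 2 by ring, show b - 1 + 1 = b by ring] at e2 e3
  rw [show N - 1 + a - (b - 1) = N + a - b by ring] at e2
  have e4 : r ^ (4 * N - 4) = r ^ (2 * (N + a - b)) * r ^ (2 * (N - 1 - a + (b - 1))) := by
    rw [← zpow_add₀ hr0.ne']; congr 1; ring
  rw [e4]
  linear_combination e1 + r ^ (2 * (N + a - b)) * e3 - e2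

lemma SS_rec3 {q r : ℝ} (h0 : 0 < q) (h1 : q < 1) (hr0 : 0 < r) (hr : q = r ^ 4)
    (p a N : ℤ) (hp : 1 ≤ p) (hN : 2 ≤ N) :
    SS q r p a N 2 = SS q r p a (N - 1) 3 + r ^ (4 * N - 4) * SS q r p a (N - 2) 2 := by
  have e1 := SS_rec h0 h1 hr0 hr p a N 2 hp (by omega)
  have e3 := SS2_rec h0 h1 hr0 hr p a (N - 1) 1 hp (by omega)
  rw [show N - 1 - 1 = N - 2 by ring, show (1 : ℤ) - 1 = 0 by ring, SS2_zero] at e3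
  norm_num at e1 e3
  have e4 : r ^ (4 * N - 4) = r ^ (2 * (N + a - 2)) * r ^ (2 * (N - 1 - a + 1)) := by
    rw [← zpow_add₀ hr0.ne']; congr 1; ring
  rw [e4]
  linear_combination e1 + r ^ (2 * (N + a - 2)) * e3

lemma SS_one {q r : ℝ} (h0 : 0 < q) (h1 : q < 1) (hr0 : 0 < r) (hr : q = r ^ 4)
    (p a b : ℤ) (ha : 1 ≤ a) (ha2 : a < p) (hb : 1 ≤ b) (hb2 : b + 1 ≤ p) :
    SS q r p a 1 b = (if a = b + 1 then 1 else 0) + (if a = b - 1 then 1 else 0) := by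
  rw [SS_rec h0 h1 hr0 hr p a 1 b (by omega) le_rfl, show (1 : ℤ) - 1 = 0 by ring,
    SS_init h0 h1 p a _ ha ha2 (by omega) hb2, SS2_init h0 h1 p a _ ha ha2 (by omega) (by omega)]
  congr 1
  split_ifs with h
  · subst h
    rw [show 2 * (1 + (b - 1) - b) = 0 by ring]; simp
  · simp

/-- The main identity: fermionic and bosonic one-variable sums agree. -/
lemma main_xx {q r : ℝ} (h0 : 0 < q) (h1 : q < 1) (hr0 : 0 < r) (hr : q = r ^ 4)
    (n a a' : ℕ) (hn : 1 ≤ n) (ha1 : 1 ≤ a) (ha' : 1 ≤ a') (haa : a + a' = n + 2) (N : ℕ) :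
    ∀ c : ℕ, 1 ≤ c → c ≤ n + 1 →
      r ^ ((a : ℤ) - (c + 1) + N ^ 2) * Zf q r n (Dv n a') (Av N c)
        = SS q r ((n : ℤ) + 3) a N (c + 1) := by
  have hr0' := hr0.ne'
  induction N using Nat.strong_induction_on with
  | _ N ih =>
  intro c hc1 hc2
  rcases N with _ | _ | N
  · rw [Nat.cast_zero, Z0 h0 h1 hn hc2 (by omega) ha',
      SS_init h0 h1 _ _ _ (by omega) (by omega) (by omega) (by omega)]
    by_cases h : c + a' = n + 1
    · rw [if_pos h, if_pos (by omega), show (a : ℤ) - (c + 1) + 0 ^ 2 = 0 by push_cast; omega]; simp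
    · rw [if_neg h, if_neg (by omega)]; simp
  · rw [zero_add, Nat.cast_one, SS_one h0 h1 hr0 hr _ _ _ (by omega) (by omega) (by omega) (by omega)]
    rcases c with _ | _ | i
    · omega
    · rw [zero_add, Zrec1 h0 h1 hr0 hr n hn _ (Dv_nonneg n a') 1 (by omega)]
      have e : Zf q r n (Dv n a') (Av (1 - 2) 1) = Zf q r n (Dv n a') (Av 0 0) := by
        apply Zf_congr
        intro i hi _
        simp only [Av, ev, show i ≠ 0 by omega, if_false]; ring
      rw [e, show (1 : ℤ) - 1 = 0 by ring, Z0 h0 h1 hn (by omega) (by omega) ha',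
        Z0 h0 h1 hn (by omega) (by omega) ha']
      have z1 : (a : ℤ) = ((1 : ℕ) : ℤ) + 1 + 1 ↔ 2 + a' = n + 1 := by omega
      have z2 : (a : ℤ) = ((1 : ℕ) : ℤ) + 1 - 1 ↔ 0 + a' = n + 1 := by omega
      simp only [z1, z2]
      by_cases c1 : 2 + a' = n + 1
      · obtain rfl : a = 3 := by omega
        rw [if_pos c1, if_neg (by omega), add_zero, zero_add, mul_one, ← zpow_add₀ hr0']
        norm_num
      · rw [if_neg c1]
        by_cases c2 : 0 + a' = n + 1
        · obtain rfl : a = 1 := by omega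
          rw [if_pos c2]; norm_num
        · rw [if_neg c2]; norm_num
    · rw [Zrec h0 h1 hr0 hr n hn _ (Dv_nonneg n a') 1 le_rfl i (by omega),
        show (2 : ℤ) - 2 * 1 = 0 by ring, show (1 : ℤ) - 1 = 0 by ring,
        Z0 h0 h1 hn (by omega) (by omega) ha']
      have hzx : Zx q r n (Dv n a') 0 (i + 3) = if i + 3 + a' = n + 1 then 1 else 0 := by
        unfold Zx
        split_ifs with g1 g2 g2
        · rw [Z0 h0 h1 hn g1 (by omega) ha', if_pos g2]
        · rw [Z0 h0 h1 hn g1 (by omega) ha', if_neg g2]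
        · omega
        · rfl
      rw [hzx]
      have z1 : (a : ℤ) = ((i + 1 + 1 : ℕ) : ℤ) + 1 + 1 ↔ i + 3 + a' = n + 1 := by omega
      have z2 : (a : ℤ) = ((i + 1 + 1 : ℕ) : ℤ) + 1 - 1 ↔ i + 1 + a' = n + 1 := by omega
      simp only [z1, z2]
      rw [zpow_zero, one_mul, one_mul]
      by_cases c1 : i + 3 + a' = n + 1
      · have e1 : (a : ℤ) = i + 4 := by omega
        rw [if_pos c1, if_neg (by omega), mul_one, add_zero, add_zero, add_sub_cancel,
          ← zpow_add₀ hr0', e1]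
        rw [show ((i : ℤ) + 4 - (((i + 1 + 1 : ℕ) : ℤ) + 1) + 1 ^ 2 + -2) = 0 by push_cast; ring]
        simp
      · rw [if_neg c1]
        by_cases c2 : i + 1 + a' = n + 1
        · have e1 : (a : ℤ) = i + 2 := by omega
          rw [if_pos c2, e1]
          rw [show ((i : ℤ) + 2 - (((i + 1 + 1 : ℕ) : ℤ) + 1) + 1 ^ 2) = 0 by push_cast; ring]
          simp
        · rw [if_neg c2]; simp
  · have ih1 := ih (N + 1) (by omega)
    have ih2 := ih N (by omega)
    have t1 : ((N + 1 + 1 : ℕ) : ℤ) - 1 = ((N + 1 : ℕ) : ℤ) := by push_cast; ring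
    have t2 : ((N + 1 + 1 : ℕ) : ℤ) - 2 = ((N : ℕ) : ℤ) := by push_cast; ring
    rcases c with _ | _ | i
    · omega
    · rw [zero_add, Zrec1 h0 h1 hr0 hr n hn _ (Dv_nonneg n a') _ (by omega)]
      have e := SS_rec3 h0 h1 hr0 hr ((n : ℤ) + 3) a ((N + 1 + 1 : ℕ) : ℤ) (by omega) (by omega)
      rw [t1, t2] at *
      push_cast
      push_cast at e
      rw [e]
      have f1 := ih1 2 (by omega) (by omega)
      have f2 := ih2 1 (by omega) (by omega)
      push_cast at f1 f2
      norm_num at f1 f2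
      rw [← f1, ← f2, mul_add, ← mul_assoc, ← mul_assoc, ← zpow_add₀ hr0', ← zpow_add₀ hr0']
      rw [add_comm]
      congr 3 <;> ring
    · rw [Zrec h0 h1 hr0 hr n hn _ (Dv_nonneg n a') _ (by omega) i (by omega)]
      have e := SS_rec2 h0 h1 hr0 hr ((n : ℤ) + 3) a ((N + 1 + 1 : ℕ) : ℤ)
        (((i + 1 + 1 : ℕ) : ℤ) + 1) (by omega) (by omega)
      rw [t1, t2] at *
      rw [e]
      have f2 := ih2 (i + 2) (by omega) hc2
      have f1 := ih1 (i + 1) (by omega) (by omega)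
      have f3 : r ^ ((a : ℤ) - ((i + 3 : ℕ) + 1) + ((N + 1 : ℕ) : ℤ) ^ 2)
          * Zx q r n (Dv n a') ((N + 1 : ℕ) : ℤ) (i + 3)
          = SS q r ((n : ℤ) + 3) a ((N + 1 : ℕ) : ℤ) ((i + 3 : ℕ) + 1) := by
        unfold Zx
        split_ifs with g
        · exact ih1 (i + 3) (by omega) g
        · rw [mul_zero, show ((i + 3 : ℕ) : ℤ) + 1 = n + 3 by omega, SS_p _ _ _ _ _ (by omega)]
      rw [show ((i + 1 + 1 : ℕ) : ℤ) + 1 + 1 = ((i + 3 : ℕ) : ℤ) + 1 by push_cast; ring, ← f3,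
        show ((i + 1 + 1 : ℕ) : ℤ) + 1 - 1 = ((i + 1 : ℕ) : ℤ) + 1 by push_cast; ring, ← f1,
        show ((i + 1 + 1 : ℕ) : ℤ) = ((i + 2 : ℕ) : ℤ) by push_cast; ring, ← f2]
      set X := r ^ ((a : ℤ) - ((i + 2 : ℕ) + 1) + (N : ℤ) ^ 2) with hX
      have y0 : r ^ ((a : ℤ) - ((i + 2 : ℕ) + 1) + ((N + 1 + 1 : ℕ) : ℤ) ^ 2)
          = X * r ^ (4 * ((N + 1 + 1 : ℕ) : ℤ) - 4) := by
        rw [hX, ← zpow_add₀ hr0']; congr 1; push_cast; ring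
      have y1 : r ^ ((a : ℤ) - ((i + 3 : ℕ) + 1) + ((N + 1 : ℕ) : ℤ) ^ 2)
          = X * r ^ (4 * ((N + 1 + 1 : ℕ) : ℤ) - 4) * r ^ (2 - 2 * ((N + 1 + 1 : ℕ) : ℤ)) * r ^ (-2 : ℤ) := by
        rw [hX, ← zpow_add₀ hr0', ← zpow_add₀ hr0', ← zpow_add₀ hr0']; congr 1; push_cast; ring
      have y2 : r ^ ((a : ℤ) - ((i + 1 : ℕ) + 1) + ((N + 1 : ℕ) : ℤ) ^ 2)
          = X * r ^ (4 * ((N + 1 + 1 : ℕ) : ℤ) - 4) * r ^ (2 - 2 * ((N + 1 + 1 : ℕ) : ℤ)) := by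
        rw [hX, ← zpow_add₀ hr0', ← zpow_add₀ hr0']; congr 1; push_cast; ring
      have y3 : r ^ (4 * ((N + 1 + 1 : ℕ) : ℤ) - 4) * r ^ (2 - 2 * ((N + 1 + 1 : ℕ) : ℤ))
          * r ^ (2 - 2 * ((N + 1 + 1 : ℕ) : ℤ)) = 1 := by
        rw [← zpow_add₀ hr0', ← zpow_add₀ hr0']
        rw [show 4 * ((N + 1 + 1 : ℕ) : ℤ) - 4 + (2 - 2 * ((N + 1 + 1 : ℕ) : ℤ))
          + (2 - 2 * ((N + 1 + 1 : ℕ) : ℤ)) = 0 by ring, zpow_zero]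
      rw [y0, y1, y2]
      linear_combination (-X * Zf q r n (Dv n a') (Av (N : ℤ) (i + 2))) * y3

lemma qz {q r : ℝ} (hr : q = r ^ 4) (z : ℤ) : q ^ z = r ^ (4 * z) := by
  rw [hr, ← zpow_natCast, ← zpow_mul]; norm_cast

lemma tri_exp {q r : ℝ} (h0 : 0 < q) (h1 : q < 1) (hr : q = r ^ 4) (ν : ℤ) (L : ℕ)
    (A : ℤ) : qTri q ν L A = ∑ N ∈ range (L + 1),
      r ^ ((N : ℤ) ^ 2 - A ^ 2 - 2 * ν * (N - A)) * (gb q L N * bb q N A) := by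
  unfold qTri
  split_ifs with hA
  swap
  · symm
    apply Finset.sum_eq_zero
    intro N hN
    rw [mem_range] at hN
    by_contra hc
    have := (bb_ne_zero (right_ne_zero_of_mul (right_ne_zero_of_mul hc))).1
    omega
  rw [abs_le] at hA
  rw [← Finset.sum_filter]
  have : ∑ N ∈ range (L + 1), r ^ ((N : ℤ) ^ 2 - A ^ 2 - 2 * ν * (N - A)) * (gb q L N * bb q N A)
      = ∑ N ∈ (range (L + 1)).filter (fun N : ℕ => |A| ≤ (N : ℤ) ∧ ((N : ℤ) - A) % 2 = 0),
        r ^ ((N : ℤ) ^ 2 - A ^ 2 - 2 * ν * (N - A)) * (gb q L N * bb q N A) := by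
    symm
    apply Finset.sum_filter_of_ne
    intro N hN hc
    exact bb_ne_zero (right_ne_zero_of_mul (right_ne_zero_of_mul hc))
  rw [this]
  refine Finset.sum_nbij' (fun j : ℕ => (2 * (j : ℤ) + A).toNat) (fun N : ℕ => (((N : ℤ) - A) / 2).toNat)
    ?_ ?_ ?_ ?_ ?_
  · intro j hj
    simp only [mem_filter, mem_range] at hj ⊢
    rw [abs_le]
    omega
  · intro j hj
    simp only [mem_filter, mem_range] at hj ⊢
    rw [abs_le] at hj
    omega
  · intro j hj
    simp only [mem_filter, mem_range] at hj ⊢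
    omega
  · intro j hj
    simp only [mem_filter, mem_range] at hj ⊢
    rw [abs_le] at hj
    omega
  · intro j hj
    simp only [mem_filter, mem_range] at hj
    have hN : (((2 * (j : ℤ) + A).toNat : ℕ) : ℤ) = 2 * j + A := Int.toNat_of_nonneg (by omega)
    rw [hN]
    unfold bb gb
    rw [if_pos (by omega), if_pos (by omega), if_pos (by omega), qz hr]
    rw [show (2 * (j : ℤ) + A - A) / 2 = j by omega, show 2 * (j : ℤ) + A - j = j + A by ring,
      show (L : ℤ) - (2 * j + A) = L - 2 * j - A by ring]
    simp only [Int.toNat_natCast]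
    have e1 := (qPoch_pos h0 h1 (2 * (j : ℤ) + A).toNat).ne'
    have e2 := (qPoch_pos h0 h1 j).ne'
    have e3 := (qPoch_pos h0 h1 ((j : ℤ) + A).toNat).ne'
    have e4 := (qPoch_pos h0 h1 ((L : ℤ) - 2 * j - A).toNat).ne'
    rw [show (2 * (j : ℤ) + A) ^ 2 - A ^ 2 - 2 * ν * (2 * (j : ℤ) + A - A) = 4 * (j * (j + A - ν)) by ring]
    field_simp

lemma bos_gen {q r : ℝ} (h0 : 0 < q) (h1 : q < 1) (hr0 : 0 < r) (hr : q = r ^ 4) (ν : ℤ) (L : ℕ)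
    (p a b w : ℤ) (hp : 1 ≤ p) (E1 E2 : ℤ → ℤ)
    (hE1 : ∀ j, w + 4 * E1 j - (2 * p * j + a - b) ^ 2 + 2 * ν * (2 * p * j + a - b)
      = (b - a) + 4 * (j * (p * j + a - p)))
    (hE2 : ∀ j, w + 4 * E2 j - (2 * p * j + a + b) ^ 2 + 2 * ν * (2 * p * j + a + b)
      = (b - a) + 4 * ((j + 1) * (p * j + a))) :
    r ^ w * ∑' j : ℤ, (q ^ E1 j * qTri q ν L (2 * p * j + a - b)
      - q ^ E2 j * qTri q ν L (2 * p * j + a + b))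
      = ∑ N ∈ range (L + 1), r ^ ((b - a) + (N : ℤ) ^ 2 - 2 * ν * N) * gb q L N * SS q r p a N b := by
  unfold SS
  simp_rw [← tsum_mul_left]
  rw [← Summable.tsum_finsetSum (f := fun (N : ℕ) (j : ℤ) =>
    r ^ (b - a + (N : ℤ) ^ 2 - 2 * ν * N) * gb q L N * St q r p a N b j)
    (fun N _ => (St_summable q r p a N b hp).mul_left _)]
  refine tsum_congr fun j => ?_
  rw [tri_exp h0 h1 hr, tri_exp h0 h1 hr, Finset.mul_sum, Finset.mul_sum, ← Finset.sum_sub_distrib,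
    Finset.mul_sum]
  refine Finset.sum_congr rfl fun N _ => ?_
  unfold St
  rw [qz hr, qz hr]
  have e1 : r ^ w * r ^ (4 * E1 j) * r ^ ((N : ℤ) ^ 2 - (2 * p * j + a - b) ^ 2 - 2 * ν * (N - (2 * p * j + a - b)))
      = r ^ ((b - a) + (N : ℤ) ^ 2 - 2 * ν * N) * r ^ (4 * (j * (p * j + a - p))) := by
    rw [← zpow_add₀ hr0.ne', ← zpow_add₀ hr0.ne', ← zpow_add₀ hr0.ne']
    congr 1
    linear_combination hE1 j
  have e2 : r ^ w * r ^ (4 * E2 j) * r ^ ((N : ℤ) ^ 2 - (2 * p * j + a + b) ^ 2 - 2 * ν * (N - (2 * p * j + a + b)))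
      = r ^ ((b - a) + (N : ℤ) ^ 2 - 2 * ν * N) * r ^ (4 * ((j + 1) * (p * j + a))) := by
    rw [← zpow_add₀ hr0.ne', ← zpow_add₀ hr0.ne', ← zpow_add₀ hr0.ne']
    congr 1
    linear_combination hE2 j
  linear_combination (gb q L N * bb q N (2 * p * j + a - b)) * e1
    - (gb q L N * bb q N (2 * p * j + a + b)) * e2

lemma bos_odd {q r : ℝ} (h0 : 0 < q) (h1 : q < 1) (hr0 : 0 < r) (hr : q = r ^ 4) (L : ℕ)
    (p a b : ℤ) (hp : 1 ≤ p) :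
    r ^ ((b - a) * (b - a + 1)) * Bpoly q p a b (b + 1) L
      = ∑ N ∈ range (L + 1), r ^ ((b - a) + (N : ℤ) ^ 2 - 2 * 0 * N) * gb q L N * SS q r p a N b := by
  unfold Bpoly
  apply bos_gen h0 h1 hr0 hr 0 L p a b _ hp <;> (intro j; ring)

lemma bos_even {q r : ℝ} (h0 : 0 < q) (h1 : q < 1) (hr0 : 0 < r) (hr : q = r ^ 4) (L : ℕ)
    (p a b : ℤ) (hp : 1 ≤ p) :
    r ^ ((b - a) * (b - a + 3)) * Btpoly q p a b (b + 2) L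
      = ∑ N ∈ range (L + 1), r ^ ((b - a) + (N : ℤ) ^ 2 - 2 * 1 * N) * gb q L N * SS q r p a N b := by
  unfold Btpoly
  apply bos_gen h0 h1 hr0 hr 1 L p a b _ hp <;> (intro j; ring)

lemma qBinQ_hb (q : ℝ) (t : ℤ) (m : ℕ) : qBinQ q ((t : ℚ) / 2) m = hb q t m := by
  unfold hb
  split_ifs with h
  · obtain ⟨s, rfl⟩ : ∃ s, t = 2 * s := ⟨t / 2, by omega⟩
    have e : (((2 * s : ℤ) : ℚ) / 2) = (s : ℚ) := by push_cast; ring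
    rw [e, show 2 * s / 2 = s by omega]
    unfold qBinQ gb
    have e2 : ((m : ℚ) ≤ (s : ℚ)) ↔ ((m : ℤ) ≤ s) := by exact_mod_cast Iff.rfl
    simp only [Rat.den_intCast, Rat.num_intCast, true_and, e2, Int.natCast_nonneg, Int.toNat_natCast]
    split_ifs with h2
    · rw [show (s - (m : ℤ)).toNat = s.toNat - m by omega]
    · rfl
  · unfold qBinQ
    rw [if_neg]
    rintro ⟨h1, -⟩
    have e := Rat.coe_int_num_of_den_eq_one h1
    have e2 : (t : ℚ) = 2 * (((t : ℚ) / 2).num : ℚ) := by rw [e]; ring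
    have e3 : t = 2 * ((t : ℚ) / 2).num := by exact_mod_cast e2
    omega

/-- Extension of a finite vector by zero. -/
def xN (p : ℕ) (m : Fin (p - 1) → ℕ) (i : ℕ) : ℤ := if h : i < p - 1 then (m ⟨i, h⟩ : ℤ) else 0

lemma xN_fin (p : ℕ) (m : Fin (p - 1) → ℕ) (i : Fin (p - 1)) : xN p m i = m i := by
  unfold xN; rw [dif_pos i.2]

lemma xN_nonneg (p : ℕ) (m : Fin (p - 1) → ℕ) (i : ℕ) : 0 ≤ xN p m i := by
  unfold xN; split_ifs <;> omega

lemma xN_big (p : ℕ) (m : Fin (p - 1) → ℕ) {i : ℕ} (h : p - 1 ≤ i) : xN p m i = 0 := by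
  unfold xN; rw [dif_neg (by omega)]

/-- Row sums of the incidence matrix. -/
def tZ (X : ℕ → ℤ) : ℕ → ℤ
  | 0 => - X 2
  | 1 => X 2
  | l + 2 => X (l + 1) + X (l + 3) + if l = 0 then X 0 else 0

lemma sum_pick (X : ℕ → ℤ) (P s : ℕ) (hX : ∀ i, P ≤ i → X i = 0) :
    ∑ j ∈ range P, (if j = s then (X j : ℚ) else 0) = X s := by
  rw [Finset.sum_ite_eq']
  split_ifs with h
  · rfl
  · rw [mem_range] at h; rw [hX s (by omega)]; simp

lemma It_sum (p : ℕ) (m : Fin (p - 1) → ℕ) (i : Fin (p - 1)) :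
    ∑ j, ItM p i j * (m j : ℚ) = tZ (xN p m) i := by
  set X := xN p m with hXd
  have hX : ∀ i, p - 1 ≤ i → X i = 0 := fun i hi => xN_big p m hi
  have hm : ∀ j, (m j : ℚ) = (X j : ℚ) := by
    intro j; rw [hXd, xN_fin]; simp
  obtain ⟨i, hi⟩ := i
  simp only [hm]
  have conv : ∀ g : ℕ → ℚ, (∀ j : Fin (p - 1), ItM p ⟨i, hi⟩ j * (X j : ℚ) = g j) →
      ∑ j, ItM p ⟨i, hi⟩ j * (X j : ℚ) = ∑ j ∈ range (p - 1), g j := by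
    intro g hg
    rw [Finset.sum_congr rfl (fun j _ => hg j), Fin.sum_univ_eq_sum_range]
  rcases i with _ | _ | l
  · rw [conv (fun j => - (if j = 2 then (X j : ℚ) else 0)), Finset.sum_neg_distrib, sum_pick X _ _ hX]
    · simp [tZ]
    · intro j; unfold ItM; simp
      try (split_ifs <;> simp)
  · rw [conv (fun j => (if j = 2 then (X j : ℚ) else 0)), sum_pick X _ _ hX]
    · simp [tZ]
    · intro j
      unfold ItM
      simp only [zero_add, one_ne_zero, if_false]
      by_cases h1 : j.val = 0
      · simp [h1]
      · have : (1 = j.val + 1 ∨ j.val = 1 + 1) ↔ j.val = 2 := by omega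
        simp only [h1, if_false, this]
        split_ifs <;> simp
  · rw [conv (fun j => (if j = l + 1 then (X j : ℚ) else 0) + (if j = l + 3 then (X j : ℚ) else 0)
        + (if l = 0 then (if j = 0 then (X j : ℚ) else 0) else 0))]
    · rw [Finset.sum_add_distrib, Finset.sum_add_distrib, sum_pick X _ _ hX, sum_pick X _ _ hX]
      simp only [tZ]
      split_ifs
      · rw [sum_pick X _ _ hX]; push_cast; rfl
      · simp
    · intro j
      unfold ItM
      rw [if_neg (by simp)]
      simp only
      by_cases h1 : j.val = 0
      · simp only [h1, if_true]
        by_cases h2 : l = 0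
        · simp [h2]
        · simp [h2]
      · rw [if_neg h1, if_neg h1]
        by_cases h2 : j.val = l + 1
        · simp [h2]
        · by_cases h3 : j.val = l + 3
          · simp [h3]
          · have : ¬ (l + 1 + 1 = j.val + 1 ∨ j.val = l + 1 + 1 + 1) := by omega
            rw [if_neg this]; simp [h2, h3]

lemma PhiQ_eq (p : ℕ) (A : Fin (p - 1) → ℚ) (m : Fin (p - 1) → ℕ) (B : ℕ → ℤ)
    (hA : ∀ j : Fin (p - 1), A j = B j) :
    4 * PhiQ p A m = ((∑ i ∈ range (p - 1), (xN p m i * (2 * xN p m i - tZ (xN p m) i - 2 * B i)) : ℤ) : ℚ) := by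
  unfold PhiQ
  have e1 : ∀ i, ∑ j, (m i : ℚ) * CtM p i j * (m j : ℚ)
      = (m i : ℚ) * (2 * m i - tZ (xN p m) i) := by
    intro i
    rw [← It_sum]
    simp only [CtM, mul_sub, sub_mul, Finset.sum_sub_distrib, Finset.mul_sum]
    congr 1
    · rw [Finset.sum_eq_single i]
      · simp; ring
      · intro j _ hj; simp [Ne.symm hj]
      · simp
    · refine Finset.sum_congr rfl fun j _ => by ring
  rw [Finset.sum_congr rfl (fun i _ => e1 i)]
  rw [show ∀ x y : ℚ, 4 * (x / 4 - y / 2) = x - 2 * y by intros; ring, Finset.mul_sum,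
    ← Finset.sum_sub_distrib]
  push_cast
  rw [← Fin.sum_univ_eq_sum_range (fun i => ((xN p m i : ℚ) * (2 * xN p m i - tZ (xN p m) i - 2 * B i)))]
  refine Finset.sum_congr rfl fun i _ => ?_
  rw [hA, xN_fin]; push_cast; ring

/-- Shifted components. -/
def kx (p : ℕ) (m : Fin (p - 1) → ℕ) (i : ℕ) : ℤ := if i = 0 then 0 else xN p m (i + 1)

/-- Unified summand. -/
def GG (q r : ℝ) (n a' c L : ℕ) (ε : ℤ) (x : (ℕ × ℕ) × (ℕ → ℤ)) : ℝ :=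
  r ^ (2 * (x.1.1 : ℤ) ^ 2 + 2 * (x.1.2 : ℤ) ^ 2 - 2 * ε * x.1.2 + 2 * x.1.1 * x.2 1)
    * (hb q (2 * L - x.2 1 - ε) x.1.1 * hb q (x.2 1 + ε) x.1.2)
    * wt q r n (Dv n a') (Av ((x.1.1 + x.1.2 : ℕ) : ℤ) c) x.2

lemma term_eq {q r : ℝ} (h0 : 0 < q) (h1 : q < 1) (hr0 : 0 < r) (hr : q = r ^ 4) (p n a' c L : ℕ) (ε : ℤ)
    (hn : 1 ≤ n) (hp : p = n + 3) (ha1 : 1 ≤ a') (hc1 : 1 ≤ c)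
    (hrq : ∀ z : ℤ, ∀ x : ℚ, 4 * x = z → q ^ (x : ℝ) = r ^ z)
    (u A : Fin (p - 1) → ℚ)
    (hu : ∀ j, u j = ((ev (a' + 1) j + ev (c + 1) j + ε * (ev 1 j - ev 0 j) : ℤ) : ℚ))
    (hA : ∀ j, A j = ((ev (c + 1) j + ε * ev 1 j : ℤ) : ℚ))
    (kk : ℕ) (hk : ((kk : ℤ) + ev c (n + 1) + ev a' (n + 1) + 1) % 2 = 0)
    (m : Fin (p - 1) → ℕ) :
    (if mlast p m % 2 = kk % 2 then
      q ^ ((PhiQ p A m : ℝ)) * ∏ i, qBinQ q (topVec p L u m i) (m i)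
    else 0) = GG q r n a' c L ε (((xN p m 0).toNat, (xN p m 1).toNat), kx p m) := by
  have hx0 : (((xN p m 0).toNat : ℕ) : ℤ) = xN p m 0 := Int.toNat_of_nonneg (xN_nonneg _ _ _)
  have hx1 : (((xN p m 1).toNat : ℕ) : ℤ) = xN p m 1 := Int.toNat_of_nonneg (xN_nonneg _ _ _)
  have hlast : (mlast p m : ℤ) = kx p m n := by
    unfold mlast kx xN
    rw [dif_pos (by omega), if_neg (by omega), dif_pos (by omega)]
    congr 2
    ext; simp; omega
  have hPhi := PhiQ_eq p A m (fun j => ev (c + 1) j + ε * ev 1 j) hA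
  rw [hrq _ _ hPhi]
  have hprod : ∏ i, qBinQ q (topVec p L u m i) (m i)
      = ∏ i ∈ range (p - 1), hb q (tZ (xN p m) i + 2 * L * ev 0 i
        + (ev (a' + 1) i + ev (c + 1) i + ε * (ev 1 i - ev 0 i))) (xN p m i) := by
    rw [← Fin.prod_univ_eq_prod_range (fun i => hb q (tZ (xN p m) i + 2 * L * ev 0 i
        + (ev (a' + 1) i + ev (c + 1) i + ε * (ev 1 i - ev 0 i))) (xN p m i))]
    refine Finset.prod_congr rfl fun i _ => ?_
    rw [xN_fin, ← qBinQ_hb]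
    congr 1
    unfold topVec
    rw [It_sum, hu]
    have : evec p 0 i = ((ev 0 i : ℤ) : ℚ) := by unfold evec ev; split_ifs <;> simp
    rw [this]
    push_cast; ring
  rw [hprod]
  unfold GG
  dsimp only
  rw [hx0, hx1, Nat.cast_add, hx0, hx1]
  set X := xN p m with hX
  have hkx : ∀ i, kx p m (i + 1) = X (i + 2) := by intro i; unfold kx; rw [if_neg (by omega)]
  have hkx0 : kx p m 0 = 0 := by unfold kx; rw [if_pos rfl]
  have hkbig : ∀ i, n < i → kx p m i = 0 := by
    intro i hi
    unfold kx
    rw [if_neg (by omega), xN_big p m (by omega)]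
  set k := kx p m with hkd
  have hwt : wt q r n (Dv n a') (Av (X 0 + X 1) c) k
      = r ^ (wE n (Av (X 0 + X 1) c) k) * wP q n (fun i => Av (X 0 + X 1) c i + Dv n a' i) k := by
    unfold wt; rw [if_pos ⟨hkx0, hkbig⟩]
  rw [hwt]
  rw [show p - 1 = n + 1 + 1 by omega]
  rw [Finset.prod_range_succ', Finset.prod_range_succ', Finset.sum_range_succ', Finset.sum_range_succ']
  unfold wP wE
  rw [Finset.prod_range_succ _ n, Finset.sum_range_succ _ n, hkbig (n + 1) (by omega),
    hkbig (n + 2) (by omega)]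
  have hP : ∀ l ∈ range n, hb q (tZ X (l + 1 + 1) + 2 * L * ev 0 (l + 1 + 1)
        + (ev (a' + 1) (l + 1 + 1) + ev (c + 1) (l + 1 + 1)
        + ε * (ev 1 (l + 1 + 1) - ev 0 (l + 1 + 1)))) (X (l + 1 + 1))
      = hb q (k l + k (l + 2) + (Av (X 0 + X 1) c (l + 1) + Dv n a' (l + 1))) (k (l + 1)) := by
    intro l hl
    rw [mem_range] at hl
    rw [hkx l, hkx (l + 1)]
    congr 1
    unfold Av Dv
    have t : tZ X (l + 1 + 1) = k l + X (l + 1 + 2) + (X 0 + X 1) * ev 1 (l + 1) := by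
      rcases l with _ | l
      · simp [tZ, ev, hkx0]; ring
      · simp [tZ, ev, hkx l]
    rw [t]
    have s1 : ev (n + 1) (l + 1) = 0 := by unfold ev; rw [if_neg (by omega)]
    have s2 : ev (a' + 1) (l + 1 + 1) = ev a' (l + 1) := by simp [ev]
    have s3 : ev (c + 1) (l + 1 + 1) = ev c (l + 1) := by simp [ev]
    rw [s1, s2, s3]
    simp [ev]; ring
  have hS : ∀ l ∈ range n, X (l + 1 + 1) * (2 * X (l + 1 + 1) - tZ X (l + 1 + 1)
        - 2 * (ev (c + 1) (l + 1 + 1) + ε * ev 1 (l + 1 + 1)))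
      = k (l + 1) * (2 * k (l + 1) - k l - k (l + 2) - 2 * Av (X 0 + X 1) c (l + 1))
        + if l = 0 then k 1 * (X 0 + X 1) else 0 := by
    intro l hl
    have s3 : ev (c + 1) (l + 1 + 1) = ev c (l + 1) := by simp [ev]
    rw [hkx l, hkx (l + 1), s3]
    unfold Av
    rcases l with _ | l
    · have e1 : ev 1 (0 + 1 + 1) = 0 := by simp [ev]
      have e2 : ev 1 (0 + 1) = 1 := by simp [ev]
      rw [e1, e2, hkx0, hkx 0, if_pos rfl]
      generalize ev c (0 + 1) = E
      simp only [tZ, if_true]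
      ring
    · have e1 : ev 1 (l + 1 + 1 + 1) = 0 := by simp [ev]
      have e2 : ev 1 (l + 1 + 1) = 0 := by simp [ev]
      rw [e1, e2, hkx l, if_neg (by omega)]
      generalize ev c (l + 1 + 1) = E
      simp only [tZ, if_neg (Nat.succ_ne_zero l)]
      ring
  rw [Finset.prod_congr rfl hP, Finset.sum_congr rfl hS, Finset.sum_add_distrib]
  have hs0 : ∑ l ∈ range n, (if l = 0 then k 1 * (X 0 + X 1) else 0) = k 1 * (X 0 + X 1) := by
    rw [Finset.sum_ite_eq', if_pos (by simp; omega)]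
  rw [hs0]
  have hk1 : k 1 = X 2 := hkx 0
  have v0 : tZ X 0 + 2 * L * ev 0 0 + (ev (a' + 1) 0 + ev (c + 1) 0 + ε * (ev 1 0 - ev 0 0))
      = 2 * L - k 1 - ε := by
    rw [hk1]; simp [tZ, ev]; ring
  have v1 : tZ X (0 + 1) + 2 * L * ev 0 (0 + 1) + (ev (a' + 1) (0 + 1) + ev (c + 1) (0 + 1)
      + ε * (ev 1 (0 + 1) - ev 0 (0 + 1))) = k 1 + ε := by
    rw [hk1]; simp [tZ, ev, show a' ≠ 0 by omega, show c ≠ 0 by omega,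
      show (0 : ℕ) ≠ a' by omega, show (0 : ℕ) ≠ c by omega]
  rw [v0, v1]
  have w0 : X 0 * (2 * X 0 - tZ X 0 - 2 * (ev (c + 1) 0 + ε * ev 1 0)) = X 0 * (2 * X 0 + k 1) := by
    rw [hk1]; simp [tZ, ev]
  have w1 : X (0 + 1) * (2 * X (0 + 1) - tZ X (0 + 1) - 2 * (ev (c + 1) (0 + 1) + ε * ev 1 (0 + 1)))
      = X 1 * (2 * X 1 - k 1 - 2 * ε) := by
    rw [hk1]; simp [tZ, ev, show (0 : ℕ) ≠ c by omega, show c ≠ 0 by omega]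
  rw [w0, w1]
  have hA1 : Av (X 0 + X 1) c (n + 1) + Dv n a' (n + 1) = ev c (n + 1) + ev a' (n + 1) + 1 := by
    unfold Av Dv
    have : ev 1 (n + 1) = 0 := by simp [ev]; omega
    have h2 : ev (n + 1) (n + 1) = 1 := by simp [ev]
    rw [this, h2]; ring
  have hev : 0 ≤ ev c (n + 1) + ev a' (n + 1) := by unfold ev; split_ifs <;> norm_num
  have hkn : 0 ≤ k n := by rw [← hlast]; omega
  have hl : hb q (k n + 0 + (Av (X 0 + X 1) c (n + 1) + Dv n a' (n + 1))) 0
      = if mlast p m % 2 = kk % 2 then 1 else 0 := by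
    rw [hA1]
    unfold hb
    by_cases hpar : mlast p m % 2 = kk % 2
    · rw [if_pos hpar, if_pos (by omega), gb_zero_right h0 h1 (by omega)]
    · rw [if_neg hpar, if_neg (by omega)]
  beta_reduce
  rw [hl]
  split_ifs with hpar
  · have hexp : ∀ W : ℤ, r ^ (W + k 1 * (X 0 + X 1) + X 1 * (2 * X 1 - k 1 - 2 * ε) + X 0 * (2 * X 0 + k 1))
      = r ^ (2 * X 0 ^ 2 + 2 * X 1 ^ 2 - 2 * ε * X 1 + 2 * X 0 * k 1)
        * r ^ (W + 0 * (2 * 0 - k n - 0 - 2 * Av (X 0 + X 1) c (n + 1))) := by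
      intro W; rw [← zpow_add₀ hr0.ne']; congr 1; ring
    rw [hexp]
    simp only [zero_add, mul_one]
    ring
  · simp

lemma GG_ne_zero {q r : ℝ} {n a' c L : ℕ} {ε : ℤ} {x : (ℕ × ℕ) × (ℕ → ℤ)}
    (h : GG q r n a' c L ε x ≠ 0) :
    (2 * (x.1.1 : ℤ) ≤ 2 * L - x.2 1 - ε) ∧ (2 * (x.1.2 : ℤ) ≤ x.2 1 + ε) ∧
      wt q r n (Dv n a') (Av ((x.1.1 + x.1.2 : ℕ) : ℤ) c) x.2 ≠ 0 := by
  unfold GG at h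
  have h1 := right_ne_zero_of_mul h
  have h2 := right_ne_zero_of_mul (left_ne_zero_of_mul h)
  exact ⟨(hb_ne_zero (left_ne_zero_of_mul h2)).2.2, (hb_ne_zero (right_ne_zero_of_mul h2)).2.2, h1⟩

lemma tsum_GG_inj (q r : ℝ) (p n a' c L : ℕ) (ε : ℤ) (hn : 1 ≤ n) (hp : p = n + 3) :
    ∑' m : Fin (p - 1) → ℕ, GG q r n a' c L ε (((xN p m 0).toNat, (xN p m 1).toNat), kx p m)
      = ∑' x, GG q r n a' c L ε x := by
  have hinj : Function.Injective (fun m : Fin (p - 1) → ℕ =>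
      ((((xN p m 0).toNat, (xN p m 1).toNat), kx p m) : (ℕ × ℕ) × (ℕ → ℤ))) := by
    intro m m' h
    simp only [Prod.mk.injEq] at h
    obtain ⟨⟨h1, h2⟩, h3⟩ := h
    have hx : ∀ i, xN p m i = xN p m' i := by
      intro i
      have e0 := xN_nonneg p m i
      have e1 := xN_nonneg p m' i
      rcases i with _ | _ | l
      · omega
      · simp only [zero_add] at *; omega
      · have := congrFun h3 (l + 1)
        unfold kx at this
        rw [if_neg (by omega), if_neg (by omega)] at this
        exact this
    funext i
    have := hx i
    rw [xN_fin, xN_fin] at this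
    exact_mod_cast this
  refine Function.Injective.tsum_eq hinj ?_
  rintro ⟨⟨m0, m1⟩, k⟩ hx
  obtain ⟨-, -, hw⟩ := GG_ne_zero (Function.mem_support.1 hx)
  obtain ⟨k0, kb, kk⟩ := wt_ne_zero hw
  dsimp only at k0 kb kk
  refine ⟨fun i => if i.val = 0 then m0 else if i.val = 1 then m1 else (k (i.val - 1)).toNat, ?_⟩
  simp only [Prod.mk.injEq]
  refine ⟨⟨?_, ?_⟩, ?_⟩
  · unfold xN; rw [dif_pos (by omega)]; simp
  · unfold xN; rw [dif_pos (by omega)]; simp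
  · funext i
    unfold kx xN
    rcases i with _ | i
    · simp [k0]
    · rw [if_neg (by omega)]
      split_ifs with h
      · simp only [show ¬ (i + 1 + 1 = 0) by omega, show ¬ (i + 1 + 1 = 1) by omega, if_false]
        rw [show i + 1 + 1 - 1 = i + 1 by omega]
        exact Int.toNat_of_nonneg (kk i (by omega)).2.1
      · rw [kb _ (by omega)]

lemma GG_finite (q r : ℝ) (n a' c L : ℕ) (ε : ℤ) : (Function.support (GG q r n a' c L ε)).Finite := by
  have hf : (⋃ y ∈ (range (L + 1) ×ˢ range (L + 1) : Finset (ℕ × ℕ)),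
      Function.support (wt q r n (Dv n a') (Av ((y.1 + y.2 : ℕ) : ℤ) c))).Finite := by
    apply Set.Finite.biUnion (Finset.finite_toSet _)
    intro i _
    exact wt_finite _ _ _ _ _
  refine ((Finset.finite_toSet (range (L + 1) ×ˢ range (L + 1) : Finset (ℕ × ℕ))).prod hf).subset ?_
  rintro ⟨⟨m0, m1⟩, k⟩ hx
  obtain ⟨h1, h2, hw⟩ := GG_ne_zero (Function.mem_support.1 hx)
  dsimp only at h1 h2 hw
  have hm : (m0, m1) ∈ (range (L + 1) ×ˢ range (L + 1) : Finset (ℕ × ℕ)) := by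
    simp only [mem_product, mem_range]
    omega
  refine ⟨hm, ?_⟩
  simp only [Set.mem_iUnion]
  exact ⟨(m0, m1), hm, hw⟩

lemma GG_vander {q r : ℝ} (h0 : 0 < q) (h1 : q < 1) (hr0 : 0 < r) (hr : q = r ^ 4)
    (n a' c L : ℕ) (ε : ℤ) (hε : ε = 0 ∨ ε = 1) (hL : 1 ≤ L)
    (hc : c ≤ n + 1) (hc1 : 1 ≤ c) (ha : a' ≤ n + 1) (ha1 : 1 ≤ a')
    (hpar : ((n : ℤ) + c + a' + ε) % 2 = 0) (N : ℕ) (hN : N ≤ L) (k : ℕ → ℤ) :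
    ∑ x ∈ antidiagonal N, GG q r n a' c L ε (x, k)
      = r ^ (2 * (N : ℤ) ^ 2 - 2 * ε * N) * gb q L N * wt q r n (Dv n a') (Av (N : ℤ) c) k := by
  have hadd : ∀ x ∈ antidiagonal N, x.1 + x.2 = N := fun x hx => HasAntidiagonal.mem_antidiagonal.1 hx
  by_cases hw : wt q r n (Dv n a') (Av (N : ℤ) c) k = 0
  · rw [hw, mul_zero]
    refine Finset.sum_eq_zero fun x hx => ?_
    unfold GG
    dsimp only
    rw [hadd x hx, hw, mul_zero]
  · obtain ⟨e1, e2, e3, e4⟩ := wt_first hc hc1 ha ha1 (by omega) hw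
    obtain ⟨B, hB⟩ : ∃ B : ℕ, k 1 + ε = 2 * B := ⟨((k 1 + ε) / 2).toNat, by omega⟩
    obtain ⟨A, hA⟩ : ∃ A : ℕ, (A : ℤ) + B = L := ⟨L - B, by omega⟩
    have hv := vander h0 h1 A B N
    rw [hA] at hv
    rw [← hv, Finset.mul_sum, Finset.sum_mul]
    refine Finset.sum_congr rfl fun x hx => ?_
    have hx' := hadd x hx
    unfold GG
    dsimp only
    rw [hx']
    congr 1
    rw [show 2 * (L : ℤ) - k 1 - ε = 2 * A by omega, hB]
    unfold hb
    rw [if_pos (by omega), if_pos (by omega), show 2 * (A : ℤ) / 2 = A by omega,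
      show 2 * (B : ℤ) / 2 = B by omega, qz hr,
      ← mul_assoc (r ^ (2 * (N : ℤ) ^ 2 - 2 * ε * N)), ← zpow_add₀ hr0.ne']
    congr 2
    have hk : k 1 = 2 * B - ε := by omega
    rw [hk, ← hx']
    push_cast
    ring

lemma tsum_GG {q r : ℝ} (h0 : 0 < q) (h1 : q < 1) (hr0 : 0 < r) (hr : q = r ^ 4)
    (n a' c L : ℕ) (ε : ℤ) (hε : ε = 0 ∨ ε = 1) (hL : 1 ≤ L)
    (hc : c ≤ n + 1) (hc1 : 1 ≤ c) (ha : a' ≤ n + 1) (ha1 : 1 ≤ a')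
    (hpar : ((n : ℤ) + c + a' + ε) % 2 = 0) :
    ∑' x, GG q r n a' c L ε x
      = ∑ N ∈ range (L + 1), r ^ (2 * (N : ℤ) ^ 2 - 2 * ε * N) * gb q L N * Zf q r n (Dv n a') (Av (N : ℤ) c) := by
  have hs : Summable (GG q r n a' c L ε) := summable_of_hasFiniteSupport (GG_finite q r n a' c L ε)
  rw [hs.tsum_prod]
  have hsf : ∀ y, Summable fun k => GG q r n a' c L ε (y, k) := fun y => hs.prod_factor y
  rw [tsum_eq_sum (s := (range (L + 1)).biUnion (fun N => antidiagonal N))]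
  · rw [Finset.sum_biUnion]
    · refine Finset.sum_congr rfl fun N hN => ?_
      rw [← Summable.tsum_finsetSum (fun y _ => hsf y)]
      unfold Zf
      rw [← tsum_mul_left]
      refine tsum_congr fun k => ?_
      exact GG_vander h0 h1 hr0 hr n a' c L ε hε hL hc hc1 ha ha1 hpar N (by rw [mem_range] at hN; omega) k
    · intro i _ j _ hij
      rw [Function.onFun, Finset.disjoint_left]
      intro x hx hy
      rw [HasAntidiagonal.mem_antidiagonal] at hx hy
      omega
  · intro y hy
    rw [show (fun k => GG q r n a' c L ε (y, k)) = fun _ => 0 from ?_, tsum_zero]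
    funext k
    by_contra hne
    obtain ⟨u1, u2, -⟩ := GG_ne_zero hne
    dsimp only at u1 u2
    apply hy
    rw [mem_biUnion]
    exact ⟨y.1 + y.2, by rw [mem_range]; omega, by rw [HasAntidiagonal.mem_antidiagonal]⟩

lemma GG_L0 {q r : ℝ} (n a' c : ℕ) (ε : ℤ) (hε : ε = 0 ∨ ε = 1)
    (hc : c ≤ n + 1) (hc1 : 1 ≤ c) (ha : a' ≤ n + 1) (ha1 : 1 ≤ a') :
    ∑' x, GG q r n a' c 0 ε x = 0 := by
  rw [show GG q r n a' c 0 ε = fun _ => 0 from ?_, tsum_zero]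
  funext x
  by_contra hne
  obtain ⟨u1, u2, u3⟩ := GG_ne_zero hne
  obtain ⟨e1, e2, e3, e4⟩ := wt_first hc hc1 ha ha1 (by omega) u3
  push_cast at *
  omega

lemma ferm_final {q r : ℝ} (h0 : 0 < q) (h1 : q < 1) (hr0 : 0 < r) (hr : q = r ^ 4)
    (p a b L : ℕ) (hp : 4 ≤ p) (ha1 : 1 ≤ a) (ha2 : a ≤ p - 2) (hb1 : 2 ≤ b) (hb2 : b ≤ p - 1)
    (ε : ℤ) (hε : ε = 0 ∨ ε = 1) (hpar : ((a : ℤ) + b + 1 + ε) % 2 = 0) :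
    (∑' x, GG q r (p - 3) (p - a - 1) (b - 1) L ε x) + (if L = 0 ∧ a = b then (1 : ℝ) else 0)
      = ∑ N ∈ range (L + 1), r ^ (((b : ℤ) - a) + (N : ℤ) ^ 2 - 2 * ε * N) * gb q L N * SS q r p a N b := by
  rcases Nat.eq_zero_or_pos L with hL | hL
  · subst hL
    rw [GG_L0 _ _ _ ε hε (by omega) (by omega) (by omega) (by omega)]
    simp only [zero_add, Finset.sum_range_one, Nat.cast_zero, true_and]
    rw [gb_zero_right h0 h1 le_rfl, SS_init h0 h1 p a b (by omega) (by omega) (by omega) (by omega)]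
    by_cases hab : a = b
    · subst hab; simp
    · simp [hab]
  · rw [if_neg (by omega), add_zero, tsum_GG h0 h1 hr0 hr _ _ _ L ε hε hL (by omega) (by omega) (by omega)
      (by omega) (by omega)]
    refine Finset.sum_congr rfl fun N _ => ?_
    have hm := main_xx h0 h1 hr0 hr (p - 3) a (p - a - 1) (by omega) ha1 (by omega) (by omega) N (b - 1)
      (by omega) (by omega)
    rw [show (((p - 3 : ℕ) : ℤ) + 3) = p by omega, show (((b - 1 : ℕ) : ℤ) + 1) = b by omega] at hm
    rw [← hm]
    rw [show 2 * (N : ℤ) ^ 2 - 2 * ε * N = (((b : ℤ) - a) + (N : ℤ) ^ 2 - 2 * ε * N) + ((a : ℤ) - b + N ^ 2) by ring,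
      zpow_add₀ hr0.ne']
    ring

lemma fFerm_GG {q r : ℝ} (h0 : 0 < q) (h1 : q < 1) (hr0 : 0 < r) (hr : q = r ^ 4) (p n a' c L : ℕ) (ε : ℤ)
    (hn : 1 ≤ n) (hp : p = n + 3) (ha1 : 1 ≤ a') (hc1 : 1 ≤ c)
    (hrq : ∀ z : ℤ, ∀ x : ℚ, 4 * x = z → q ^ (x : ℝ) = r ^ z)
    (u A : Fin (p - 1) → ℚ)
    (hu : ∀ j, u j = ((ev (a' + 1) j + ev (c + 1) j + ε * (ev 1 j - ev 0 j) : ℤ) : ℚ))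
    (hA : ∀ j, A j = ((ev (c + 1) j + ε * ev 1 j : ℤ) : ℚ))
    (kk : ℕ) (hk : ((kk : ℤ) + ev c (n + 1) + ev a' (n + 1) + 1) % 2 = 0) :
    fFerm q p kk L u A = ∑' x, GG q r n a' c L ε x := by
  rw [← tsum_GG_inj q r p n a' c L ε hn hp]
  unfold fFerm
  exact tsum_congr fun m => term_eq h0 h1 hr0 hr p n a' c L ε hn hp ha1 hc1 hrq u A hu hA kk hk m

lemma evec_ev (p c : ℕ) (j : Fin (p - 1)) : evec p c j = ((ev c j : ℤ) : ℚ) := by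
  unfold evec ev; split_ifs <;> simp

lemma F_GG {q r : ℝ} (h0 : 0 < q) (h1 : q < 1) (hr0 : 0 < r) (hr : q = r ^ 4)
    (hrq : ∀ z : ℤ, ∀ x : ℚ, 4 * x = z → q ^ (x : ℝ) = r ^ z)
    (p a b L : ℕ) (hp : 4 ≤ p) (ha1 : 1 ≤ a) (ha2 : a ≤ p - 2) (hb1 : 2 ≤ b) (hb2 : b ≤ p - 1)
    (ε : ℤ) (hε : ε = 0 ∨ ε = 1) (hpar : ((a : ℤ) + b + 1 + ε) % 2 = 0) :
    (if a = 1 then Fpoly q p 0 1 b L else Fpoly q p 1 (p - a) b L)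
      = ∑' x, GG q r (p - 3) (p - a - 1) (b - 1) L ε x := by
  have hpt : ∀ M : ℕ, ((M : ℤ) + ε) % 2 = 0 → ptil M = (ε : ℚ) := by
    intro M hM
    unfold ptil
    rcases hε with h | h <;> subst h
    · rw [if_neg (by omega)]; simp
    · rw [if_pos (by omega)]; simp
  have hcb : b - 1 + 1 = b := by omega
  have eb : ev (b - 1) (p - 3 + 1) = if b = p - 1 then 1 else 0 := by
    unfold ev; split_ifs <;> omega
  have ea : ev (p - a - 1) (p - 3 + 1) = if a = 1 then 1 else 0 := by
    unfold ev; split_ifs <;> omega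
  by_cases haa : a = 1
  · rw [if_pos haa]
    have hP : ptil (1 + kdel 1 1 + b + kdel b 1 + (if (0 : ℕ) = 1 then p - 1 else 0)) = (ε : ℚ) := by
      apply hpt
      unfold kdel
      rw [if_pos rfl, if_neg (by omega), if_neg (by omega)]
      omega
    have hu : ∀ j, uvec p 0 1 b j = ((ev (p - a - 1 + 1) j + ev (b - 1 + 1) j
        + ε * (ev 1 j - ev 0 j) : ℤ) : ℚ) := by
      intro j
      unfold uvec
      rw [hP, if_neg (by omega), if_pos (by omega), hcb, evec_ev, evec_ev, evec_ev]
      have : ev (p - a - 1 + 1) j = 0 := by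
        unfold ev; rw [if_neg]; have := j.2; omega
      rw [this]; push_cast; ring
    have hA : ∀ j, Avec p 0 1 b j = ((ev (b - 1 + 1) j + ε * ev 1 j : ℤ) : ℚ) := by
      intro j
      unfold Avec
      rw [hP, if_pos (by omega), hcb, evec_ev, evec_ev]
      push_cast; ring
    unfold Fpoly
    split_ifs with hbp
    · exact fFerm_GG h0 h1 hr0 hr p (p - 3) _ _ L ε (by omega) (by omega) (by omega) (by omega) hrq _ _ hu hA _
        (by rw [eb, ea, if_pos hbp, if_pos haa]; norm_num)
    · exact fFerm_GG h0 h1 hr0 hr p (p - 3) _ _ L ε (by omega) (by omega) (by omega) (by omega) hrq _ _ hu hA _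
        (by rw [eb, ea, if_neg hbp, if_pos haa]; norm_num)
  · rw [if_neg haa]
    have hP : ptil (p - a + kdel (p - a) 1 + b + kdel b 1 + (if (1 : ℕ) = 1 then p - 1 else 0)) = (ε : ℚ) := by
      apply hpt
      unfold kdel
      rw [if_neg (by omega), if_neg (by omega), if_pos rfl]
      omega
    have hu : ∀ j, uvec p 1 (p - a) b j = ((ev (p - a - 1 + 1) j + ev (b - 1 + 1) j
        + ε * (ev 1 j - ev 0 j) : ℤ) : ℚ) := by
      intro j
      unfold uvec
      rw [hP, if_pos (by omega), if_pos (by omega), hcb, evec_ev, evec_ev, evec_ev, evec_ev,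
        show p - a - 1 + 1 = p - a by omega]
      push_cast; ring
    have hA : ∀ j, Avec p 1 (p - a) b j = ((ev (b - 1 + 1) j + ε * ev 1 j : ℤ) : ℚ) := by
      intro j
      unfold Avec
      rw [hP, if_pos (by omega), hcb, evec_ev, evec_ev]
      push_cast; ring
    unfold Fpoly
    split_ifs with hbp
    · exact fFerm_GG h0 h1 hr0 hr p (p - 3) _ _ L ε (by omega) (by omega) (by omega) (by omega) hrq _ _ hu hA _
        (by rw [eb, ea, if_pos hbp, if_neg haa]; norm_num)
    · exact fFerm_GG h0 h1 hr0 hr p (p - 3) _ _ L ε (by omega) (by omega) (by omega) (by omega) hrq _ _ hu hA _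
        (by rw [eb, ea, if_neg hbp, if_neg haa]; norm_num)

lemma root4 {q : ℝ} (h0 : 0 < q) : ∃ r : ℝ, 0 < r ∧ q = r ^ 4 ∧
    (∀ z : ℤ, ∀ x : ℝ, 4 * x = z → q ^ x = r ^ z) := by
  refine ⟨q ^ (1 / 4 : ℝ), Real.rpow_pos_of_pos h0 _, ?_, ?_⟩
  · rw [← Real.rpow_natCast, ← Real.rpow_mul h0.le]; norm_num
  · intro z x hx
    rw [← Real.rpow_intCast, ← Real.rpow_mul h0.le, ← hx]
    congr 1; ring

/-- For `p ≥ 4`, `1 ≤ a ≤ p-2`, `2 ≤ b ≤ p-1`, `L ≥ 0` and `0 < q < 1`: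
if `a + b` is odd then
`F^{p,1}_{p-a,b}(L) + δ_{L,0}δ_{a,b} = q^{φ(p-a,p-1)+φ(a,b)-a(a-1)/4} B^p_{a,b}(L,b+1)`,
and if `a + b` is even then
`F^{p,1}_{p-a,b}(L) + δ_{L,0}δ_{a,b} = q^{φ̃(p-a,p-1)+φ̃(a,b)-(a-1)(a+2)/4} B̃^p_{a,b}(L,b+2)`;
here, by convention, `F^{p,1}_{p-1,b}(L) ≡ F^{p,0}_{1,b}(L)`. -/
theorem odd_identity_general (p a b : ℕ) (hp : 4 ≤ p) (ha1 : 1 ≤ a) (ha2 : a ≤ p - 2)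
    (hb1 : 2 ≤ b) (hb2 : b ≤ p - 1)
    (L : ℕ) (q : ℝ) (hq0 : 0 < q) (hq1 : q < 1) :
    ((a + b) % 2 = 1 →
      (if a = 1 then Fpoly q p 0 1 b L else Fpoly q p 1 (p - a) b L)
          + (if L = 0 ∧ a = b then (1 : ℝ) else 0)
        = q ^ (phiR ((p : ℝ) - (a : ℝ)) ((p : ℝ) - 1) + phiR (a : ℝ) (b : ℝ)
              - (a : ℝ) * ((a : ℝ) - 1) / 4) * Bpoly q p a b ((b : ℤ) + 1) L) ∧
    ((a + b) % 2 = 0 →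
      (if a = 1 then Fpoly q p 0 1 b L else Fpoly q p 1 (p - a) b L)
          + (if L = 0 ∧ a = b then (1 : ℝ) else 0)
        = q ^ (phitR ((p : ℝ) - (a : ℝ)) ((p : ℝ) - 1) + phitR (a : ℝ) (b : ℝ)
              - ((a : ℝ) - 1) * ((a : ℝ) + 2) / 4) * Btpoly q p a b ((b : ℤ) + 2) L) := by
  obtain ⟨r, hr0, hr, hrq⟩ := root4 hq0
  have hrq' : ∀ z : ℤ, ∀ x : ℚ, 4 * x = z → q ^ (x : ℝ) = r ^ z := by
    intro z x hx
    exact hrq z x (by exact_mod_cast hx)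
  constructor
  · intro hab
    rw [F_GG hq0 hq1 hr0 hr hrq' p a b L hp ha1 ha2 hb1 hb2 0 (Or.inl rfl) (by omega),
      ferm_final hq0 hq1 hr0 hr p a b L hp ha1 ha2 hb1 hb2 0 (Or.inl rfl) (by omega),
      hrq (((b : ℤ) - a) * ((b : ℤ) - a + 1)) _ (by unfold phiR; push_cast; ring)]
    exact (bos_odd hq0 hq1 hr0 hr L p a b (by omega)).symm
  · intro hab
    rw [F_GG hq0 hq1 hr0 hr hrq' p a b L hp ha1 ha2 hb1 hb2 1 (Or.inr rfl) (by omega),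
      ferm_final hq0 hq1 hr0 hr p a b L hp ha1 ha2 hb1 hb2 1 (Or.inr rfl) (by omega),
      hrq (((b : ℤ) - a) * ((b : ℤ) - a + 3)) _ (by unfold phitR; push_cast; ring)]
    exact (bos_even hq0 hq1 hr0 hr L p a b (by omega)).symm
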